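/- Let k = k(r) ≥ 2 and n = n(r) = k(r)·r be sequences with λ = k − 1 and k = o(n^{1−α}) for some fixed 0 < α < 1. Let μ_n = (1/2)·log²(√(n/λ)) and σ_n = (1/√3)·log^{3/2}(√(n/λ)). Then the random variable X_n = (log T − μ_n)/σ_n on the uniform space of {0,k}-mappings on [n] converges in distribution to the standard normal as r → ∞; moreover there is a constant C > 0 such that for all real x and all sufficiently large r, |P_n^{{0,k}}(log T ≤ μ_n + x·σ_n) − φ(x)| ≤ C·(|x| + log^{1/2}(√(n/λ)))/log^{3/4}(√(n/λ)). -/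

import Mathlib

open Filter Finset Asymptotics MeasureTheory

noncomputable section

open scoped Classical

/-- `f` is a `{0,k}`-mapping: every point has either `0` or `k` preimages. -/
def IsZKMap {n : ℕ} (k : ℕ) (f : Fin n → Fin n) : Prop :=
  ∀ y : Fin n,
    (Finset.univ.filter fun x => f x = y).card = 0 ∨
    (Finset.univ.filter fun x => f x = y).card = k

/-- The finite set of `{0,k}`-mappings on `[n]`. -/
def zkMaps (n k : ℕ) : Finset (Fin n → Fin n) :=
  Finset.univ.filter fun f => IsZKMap k f

/-- The set of cyclic nodes of `f`. -/
def cyclicSet {n : ℕ} (f : Fin n → Fin n) : Finset (Fin n) :=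
  Finset.univ.filter fun x => ∃ m, 0 < m ∧ f^[m] x = x

/-- `Z f`: the number of cyclic nodes of `f`. -/
def Zmap {n : ℕ} (f : Fin n → Fin n) : ℕ := (cyclicSet f).card

/-- The cycles of `f`: the orbits of the cyclic nodes under `f`. -/
def cyclesOf {n : ℕ} (f : Fin n → Fin n) : Finset (Finset (Fin n)) :=
  (cyclicSet f).image fun x => (cyclicSet f).filter fun y => ∃ m, f^[m] x = y

/-- `T f`: the least common multiple of the cycle lengths of `f`. -/
def Tmap {n : ℕ} (f : Fin n → Fin n) : ℕ := (cyclesOf f).lcm Finset.card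

/-- `B f`: the product of the cycle lengths of `f`, counted with multiplicity. -/
def Bmap {n : ℕ} (f : Fin n → Fin n) : ℕ := ∏ c ∈ cyclesOf f, c.card

/-- `C f`: the number of cycles of `f`. -/
def Cmap {n : ℕ} (f : Fin n → Fin n) : ℕ := (cyclesOf f).card

/-- Uniform probability of the event `p` over `{0,k}`-mappings on `[n]`. -/
def zkProb (n k : ℕ) (p : (Fin n → Fin n) → Prop) : ℝ :=
  (((zkMaps n k).filter p).card : ℝ) / ((zkMaps n k).card : ℝ)

/-- Expectation of `X` under the uniform measure on `{0,k}`-mappings on `[n]`. -/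
def zkExp (n k : ℕ) (X : (Fin n → Fin n) → ℝ) : ℝ :=
  (∑ f ∈ zkMaps n k, X f) / ((zkMaps n k).card : ℝ)

/-- The standard normal cumulative distribution function. -/
def stdNormalCDF (x : ℝ) : ℝ :=
  (Real.sqrt (2 * Real.pi))⁻¹ * ∫ t in Set.Iic x, Real.exp (-t ^ 2 / 2)

/-- `M m`: the average order of a uniformly random permutation of `[m]`. -/
def Mperm (m : ℕ) : ℝ :=
  (∑ σ : Equiv.Perm (Fin m), (orderOf σ : ℝ)) / (m.factorial : ℝ)

/-! ### The standard normal distribution function and the Stein equation -/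

/-- The unnormalised Gaussian density. -/
def gaussDen (t : ℝ) : ℝ := Real.exp (-t ^ 2 / 2)

lemma gaussDen_eq (t : ℝ) : gaussDen t = Real.exp (-(1 / 2 : ℝ) * t ^ 2) := by
  unfold gaussDen; congr 1; ring

lemma gaussDen_pos (t : ℝ) : 0 < gaussDen t := Real.exp_pos _

lemma gaussDen_neg (t : ℝ) : gaussDen (-t) = gaussDen t := by
  unfold gaussDen; congr 1; ring

lemma gaussDen_le_one (t : ℝ) : gaussDen t ≤ 1 := by
  unfold gaussDen; rw [Real.exp_le_one_iff]; nlinarith [sq_nonneg t]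

lemma exp_mul_gaussDen (t : ℝ) : Real.exp (t ^ 2 / 2) * gaussDen t = 1 := by
  unfold gaussDen; rw [← Real.exp_add, ← Real.exp_zero]; congr 1; ring

lemma continuous_gaussDen : Continuous gaussDen := by unfold gaussDen; fun_prop

lemma integrable_gaussDen : Integrable gaussDen := by
  have h := integrable_exp_neg_mul_sq (b := 1 / 2) (by norm_num)
  exact h.congr (Eventually.of_forall fun t => (gaussDen_eq t).symm)

lemma integral_gaussDen : ∫ t, gaussDen t = Real.sqrt (2 * Real.pi) := by
  have h := integral_gaussian (1 / 2)
  simp_rw [gaussDen_eq, h]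
  congr 1; field_simp

lemma sqrt_two_pi_ge_one : 1 ≤ Real.sqrt (2 * Real.pi) := by
  rw [Real.one_le_sqrt]; nlinarith [Real.pi_gt_three]

lemma sqrt_two_pi_le_three : Real.sqrt (2 * Real.pi) ≤ 3 := by
  rw [Real.sqrt_le_left (by norm_num)]; nlinarith [Real.pi_lt_four]

lemma stdNormalCDF_eq (x : ℝ) :
    stdNormalCDF x = (Real.sqrt (2 * Real.pi))⁻¹ * ∫ t in Set.Iic x, gaussDen t := rfl

lemma sqrt_mul_stdNormalCDF (x : ℝ) :
    Real.sqrt (2 * Real.pi) * stdNormalCDF x = ∫ t in Set.Iic x, gaussDen t := by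
  have := sqrt_two_pi_ge_one
  rw [stdNormalCDF_eq]; field_simp

lemma stdNormalCDF_nonneg (x : ℝ) : 0 ≤ stdNormalCDF x := by
  rw [stdNormalCDF_eq]
  exact mul_nonneg (by positivity) (integral_nonneg fun t => (gaussDen_pos t).le)

lemma stdNormalCDF_add_neg (x : ℝ) : stdNormalCDF x + stdNormalCDF (-x) = 1 := by
  have h1 := intervalIntegral.integral_Iic_add_Ioi (b := x) integrable_gaussDen.integrableOn
    integrable_gaussDen.integrableOn
  have h2 := integral_comp_neg_Iic (-x) gaussDen
  simp only [gaussDen_neg, neg_neg] at h2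
  rw [← h2, integral_gaussDen, ← sqrt_mul_stdNormalCDF, ← sqrt_mul_stdNormalCDF] at h1
  have h3 := sqrt_two_pi_ge_one
  have : Real.sqrt (2 * Real.pi) * (stdNormalCDF x + stdNormalCDF (-x) - 1) = 0 := by linarith
  rcases mul_eq_zero.1 this with h | h <;> linarith

lemma stdNormalCDF_le_one (x : ℝ) : stdNormalCDF x ≤ 1 := by
  linarith [stdNormalCDF_add_neg x, stdNormalCDF_nonneg (-x)]

lemma stdNormalCDF_hasDerivAt (x : ℝ) :
    HasDerivAt stdNormalCDF ((Real.sqrt (2 * Real.pi))⁻¹ * gaussDen x) x := by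
  have h : HasDerivAt (fun u => ∫ t in (0 : ℝ)..u, gaussDen t) (gaussDen x) x :=
    intervalIntegral.integral_hasDerivAt_right (continuous_gaussDen.intervalIntegrable _ _)
      continuous_gaussDen.stronglyMeasurable.stronglyMeasurableAtFilter
      continuous_gaussDen.continuousAt
  have h2 : stdNormalCDF = fun u => (Real.sqrt (2 * Real.pi))⁻¹ *
      ((∫ t in Set.Iic (0 : ℝ), gaussDen t) + ∫ t in (0 : ℝ)..u, gaussDen t) := by
    funext u
    rw [stdNormalCDF_eq, ← intervalIntegral.integral_Iic_sub_Iic integrable_gaussDen.integrableOn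
      integrable_gaussDen.integrableOn]
    ring
  rw [h2]
  exact (h.const_add _).const_mul _

lemma abs_stdNormalCDF_sub_le (x y : ℝ) :
    |stdNormalCDF y - stdNormalCDF x| ≤ |y - x| := by
  have := Convex.norm_image_sub_le_of_norm_hasDerivWithin_le (C := 1) (s := Set.univ)
    (fun u _ => (stdNormalCDF_hasDerivAt u).hasDerivWithinAt) (fun u _ => by
      rw [Real.norm_of_nonneg (mul_nonneg (by positivity) (gaussDen_pos u).le)]
      exact mul_le_one₀ (inv_le_one_of_one_le₀ sqrt_two_pi_ge_one) (gaussDen_pos u).le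
        (gaussDen_le_one u)) convex_univ (Set.mem_univ x) (Set.mem_univ y)
  simpa using this

lemma stdNormalCDF_mono : Monotone stdNormalCDF := by
  apply monotone_of_deriv_nonneg (fun x => (stdNormalCDF_hasDerivAt x).differentiableAt)
  intro x
  rw [(stdNormalCDF_hasDerivAt x).deriv]
  exact mul_nonneg (by positivity) (gaussDen_pos x).le

/-- Mills' ratio of the left Gaussian tail. -/
def mills (w : ℝ) : ℝ := Real.sqrt (2 * Real.pi) * Real.exp (w ^ 2 / 2) * stdNormalCDF w

lemma mills_nonneg (w : ℝ) : 0 ≤ mills w :=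
  mul_nonneg (by positivity) (stdNormalCDF_nonneg w)

lemma mills_eq (w : ℝ) : mills w = Real.exp (w ^ 2 / 2) * ∫ t in Set.Iic w, gaussDen t := by
  rw [← sqrt_mul_stdNormalCDF]; unfold mills; ring

lemma mills_hasDerivAt (w : ℝ) : HasDerivAt mills (w * mills w + 1) w := by
  have h1 : HasDerivAt (fun w : ℝ => Real.exp (w ^ 2 / 2)) (Real.exp (w ^ 2 / 2) * w) w := by
    have : HasDerivAt (fun w : ℝ => w ^ 2 / 2) w w := by
      have := (hasDerivAt_pow 2 w).div_const 2
      simpa using this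
    exact this.exp
  have h2 := (h1.const_mul (Real.sqrt (2 * Real.pi))).mul (stdNormalCDF_hasDerivAt w)
  have h3 := sqrt_two_pi_ge_one
  have h4 := exp_mul_gaussDen w
  refine h2.congr_deriv ?_
  unfold mills
  have h5 : Real.sqrt (2 * Real.pi) * (Real.sqrt (2 * Real.pi))⁻¹ = 1 :=
    mul_inv_cancel₀ (by linarith)
  linear_combination (Real.exp (w ^ 2 / 2) * gaussDen w) * h5 + h4

lemma mills_le_of_nonpos {w : ℝ} (hw : w ≤ 0) : mills w ≤ 3 := by
  have h1 : ∫ t in Set.Iic w, gaussDen t ≤ ∫ t in Set.Iic w, gaussDen w * gaussDen (t - w) := by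
    apply setIntegral_mono_on integrable_gaussDen.integrableOn
      ((integrable_gaussDen.comp_sub_right w).const_mul _).integrableOn measurableSet_Iic
    intro t ht
    unfold gaussDen
    rw [← Real.exp_add, Real.exp_le_exp]
    have : t ≤ w := ht
    nlinarith
  have h2 : ∫ t in Set.Iic w, gaussDen w * gaussDen (t - w) ≤ ∫ t, gaussDen w * gaussDen (t - w) :=
    setIntegral_le_integral ((integrable_gaussDen.comp_sub_right w).const_mul _)
      (Eventually.of_forall fun t => mul_nonneg (gaussDen_pos _).le (gaussDen_pos _).le)
  rw [integral_const_mul (μ := volume), integral_sub_right_eq_self, integral_gaussDen] at h2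
  rw [mills_eq]
  calc Real.exp (w ^ 2 / 2) * ∫ t in Set.Iic w, gaussDen t
      ≤ Real.exp (w ^ 2 / 2) * (gaussDen w * Real.sqrt (2 * Real.pi)) := by gcongr; linarith
    _ = Real.sqrt (2 * Real.pi) := by rw [← mul_assoc, exp_mul_gaussDen, one_mul]
    _ ≤ 3 := sqrt_two_pi_le_three

lemma neg_mul_mills_le {w : ℝ} : -w * mills w ≤ 1 := by
  have hd : ∀ x ∈ Set.Iio w, HasDerivAt gaussDen (-x * gaussDen x) x := by
    intro x _
    have : HasDerivAt (fun w : ℝ => -w ^ 2 / 2) (-x) x := by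
      have := ((hasDerivAt_pow 2 x).neg).div_const 2
      refine this.congr_deriv ?_
      push_cast
      ring
    unfold gaussDen
    convert this.exp using 1; ring
  have hi : IntegrableOn (fun x => -x * gaussDen x) (Set.Iic w) := by
    have := (integrable_mul_exp_neg_mul_sq (b := 1 / 2) (by norm_num)).neg
    refine (this.congr (Eventually.of_forall fun t => ?_)).integrableOn
    simp [gaussDen_eq]
  have ht : Tendsto gaussDen atBot (nhds 0) := by
    unfold gaussDen
    apply Real.tendsto_exp_atBot.comp
    have : Tendsto (fun t : ℝ => t ^ 2) atBot atTop := by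
      have := (tendsto_pow_atTop (α := ℝ) (n := 2) (by norm_num)).comp tendsto_neg_atBot_atTop
      refine this.congr fun t => by simp
    have := (tendsto_neg_atTop_atBot.comp this).atBot_div_const (r := 2) (by norm_num)
    exact this
  have h := integral_Iic_of_hasDerivAt_of_tendsto continuous_gaussDen.continuousWithinAt hd hi ht
  have h1 : ∫ t in Set.Iic w, -w * gaussDen t ≤ ∫ t in Set.Iic w, -t * gaussDen t := by
    apply setIntegral_mono_on (integrable_gaussDen.const_mul _).integrableOn hi measurableSet_Iic
    intro t ht
    have : t ≤ w := ht
    exact mul_le_mul_of_nonneg_right (by linarith) (gaussDen_pos t).le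
  rw [h, integral_const_mul, sub_zero] at h1
  rw [mills_eq]
  calc -w * (Real.exp (w ^ 2 / 2) * ∫ t in Set.Iic w, gaussDen t)
      = Real.exp (w ^ 2 / 2) * (-w * ∫ t in Set.Iic w, gaussDen t) := by ring
    _ ≤ Real.exp (w ^ 2 / 2) * gaussDen w := by gcongr
    _ = 1 := exp_mul_gaussDen w

/-- The solution of the Stein equation for the indicator of `(-∞, z]`. -/
def steinSol (z w : ℝ) : ℝ :=
  if w ≤ z then mills w * stdNormalCDF (-z) else mills (-w) * stdNormalCDF z

lemma steinSol_left {z w : ℝ} (h : w ≤ z) : steinSol z w = mills w * stdNormalCDF (-z) :=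
  if_pos h

lemma mills_mul_comm (z : ℝ) :
    mills z * stdNormalCDF (-z) = mills (-z) * stdNormalCDF z := by
  unfold mills; rw [neg_sq]; ring

lemma steinSol_right {z w : ℝ} (h : z ≤ w) :
    steinSol z w = mills (-w) * stdNormalCDF z := by
  rcases h.eq_or_lt with rfl | h
  · rw [steinSol_left le_rfl, mills_mul_comm]
  · exact if_neg (not_le.2 h)

lemma steinSol_nonneg (z w : ℝ) : 0 ≤ steinSol z w := by
  unfold steinSol
  split_ifs <;> exact mul_nonneg (mills_nonneg _) (stdNormalCDF_nonneg _)

lemma steinSol_le_mills (z w : ℝ) : steinSol z w ≤ mills w ∧ steinSol z w ≤ mills (-w) := by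
  rcases le_total w z with h | h
  · rw [steinSol_left h]
    refine ⟨mul_le_of_le_one_right (mills_nonneg _) (stdNormalCDF_le_one _), ?_⟩
    calc mills w * stdNormalCDF (-z) ≤ mills w * stdNormalCDF (-w) :=
          mul_le_mul_of_nonneg_left (stdNormalCDF_mono (by linarith)) (mills_nonneg _)
      _ = mills (-w) * stdNormalCDF w := mills_mul_comm w
      _ ≤ mills (-w) := mul_le_of_le_one_right (mills_nonneg _) (stdNormalCDF_le_one _)
  · rw [steinSol_right h]
    refine ⟨?_, mul_le_of_le_one_right (mills_nonneg _) (stdNormalCDF_le_one _)⟩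
    calc mills (-w) * stdNormalCDF z ≤ mills (-w) * stdNormalCDF w :=
          mul_le_mul_of_nonneg_left (stdNormalCDF_mono h) (mills_nonneg _)
      _ = mills w * stdNormalCDF (-w) := (mills_mul_comm w).symm
      _ ≤ mills w := mul_le_of_le_one_right (mills_nonneg _) (stdNormalCDF_le_one _)

lemma steinSol_le (z w : ℝ) : steinSol z w ≤ 3 := by
  rcases le_total w 0 with h | h
  · exact (steinSol_le_mills z w).1.trans (mills_le_of_nonpos h)
  · exact (steinSol_le_mills z w).2.trans (mills_le_of_nonpos (by linarith))

lemma abs_mul_steinSol_le (z w : ℝ) : |w * steinSol z w| ≤ 1 := by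
  have h0 := steinSol_nonneg z w
  rw [abs_mul, abs_of_nonneg h0]
  rcases le_total w 0 with h | h
  · rw [abs_of_nonpos h]
    exact (mul_le_mul_of_nonneg_left (steinSol_le_mills z w).1 (by linarith)).trans
      neg_mul_mills_le
  · rw [abs_of_nonneg h]
    have := neg_mul_mills_le (w := -w)
    rw [neg_neg] at this
    exact (mul_le_mul_of_nonneg_left (steinSol_le_mills z w).2 h).trans this

lemma continuous_mills : Continuous mills :=
  continuous_iff_continuousAt.2 fun w => (mills_hasDerivAt w).continuousAt

lemma continuous_steinSol (z : ℝ) : Continuous (steinSol z) := by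
  unfold steinSol
  refine Continuous.if_le (continuous_mills.mul continuous_const)
    ((continuous_mills.comp continuous_neg).mul continuous_const) continuous_id continuous_const ?_
  rintro x rfl
  exact mills_mul_comm _

lemma steinSol_hasDerivAt_left {z w : ℝ} (h : w < z) :
    HasDerivAt (steinSol z) (w * steinSol z w + 1 - stdNormalCDF z) w := by
  have h1 := (mills_hasDerivAt w).mul_const (stdNormalCDF (-z))
  have h2 : steinSol z =ᶠ[nhds w] fun w => mills w * stdNormalCDF (-z) := by
    filter_upwards [Iio_mem_nhds h] with u hu using steinSol_left (le_of_lt hu)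
  refine (h1.congr_of_eventuallyEq h2).congr_deriv ?_
  rw [steinSol_left h.le]
  linear_combination (stdNormalCDF_add_neg z)

lemma steinSol_hasDerivAt_right {z w : ℝ} (h : z < w) :
    HasDerivAt (steinSol z) (w * steinSol z w - stdNormalCDF z) w := by
  have h1 := ((mills_hasDerivAt (-w)).comp w (hasDerivAt_neg w)).mul_const (stdNormalCDF z)
  have h2 : steinSol z =ᶠ[nhds w] fun w => mills (-w) * stdNormalCDF z := by
    filter_upwards [Ioi_mem_nhds h] with u hu using steinSol_right (le_of_lt hu)
  refine (h1.congr_of_eventuallyEq h2).congr_deriv ?_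
  rw [steinSol_right h.le]
  ring

lemma sub_le_mul_of_deriv_le {f f' : ℝ → ℝ} (hf : Continuous f) {a b K : ℝ}
    (hab : a ≤ b) (hd : ∀ u ∈ Set.Ioo a b, HasDerivAt f (f' u) u)
    (hK : ∀ u ∈ Set.Ioo a b, f' u ≤ K) : f b - f a ≤ K * (b - a) := by
  rcases hab.eq_or_lt with rfl | hlt
  · simp
  · obtain ⟨c, hc, he⟩ := exists_hasDerivAt_eq_slope f f' hlt hf.continuousOn hd
    have := hK c hc
    rw [he, div_le_iff₀ (by linarith)] at this
    exact this

/-- A mean value inequality for a function differentiable off one point. -/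
lemma sub_le_mul_of_deriv_le_off_point {f f' : ℝ → ℝ} (hf : Continuous f) {a b z K : ℝ}
    (hab : a ≤ b) (hd : ∀ u, u ≠ z → HasDerivAt f (f' u) u)
    (hK : ∀ u ∈ Set.Ioo a b, u ≠ z → f' u ≤ K) : f b - f a ≤ K * (b - a) := by
  by_cases hz : z ∈ Set.Ioo a b
  · have h1 := sub_le_mul_of_deriv_le (K := K) hf hz.1.le (fun u hu => hd u hu.2.ne)
      (fun u hu => hK u ⟨hu.1, hu.2.trans hz.2⟩ hu.2.ne)
    have h2 := sub_le_mul_of_deriv_le (K := K) hf hz.2.le (fun u hu => hd u hu.1.ne')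
      (fun u hu => hK u ⟨hz.1.trans hu.1, hu.2⟩ hu.1.ne')
    linarith
  · have hne : ∀ u ∈ Set.Ioo a b, u ≠ z := by rintro u hu rfl; exact hz hu
    exact sub_le_mul_of_deriv_le hf hab (fun u hu => hd u (hne u hu))
      (fun u hu => hK u hu (hne u hu))

/-- The derivative of the Stein solution away from `z`. -/
def steinDeriv (z w : ℝ) : ℝ :=
  w * steinSol z w + (if w ≤ z then 1 else 0) - stdNormalCDF z

lemma steinSol_hasDerivAt {z w : ℝ} (h : w ≠ z) :
    HasDerivAt (steinSol z) (steinDeriv z w) w := by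
  unfold steinDeriv
  rcases lt_or_gt_of_ne h with h | h
  · rw [if_pos h.le]; exact steinSol_hasDerivAt_left h
  · rw [if_neg (not_le.2 h), add_zero]; exact steinSol_hasDerivAt_right h

lemma abs_steinDeriv_le (z w : ℝ) : |steinDeriv z w| ≤ 2 := by
  have h1 := abs_le.1 (abs_mul_steinSol_le z w)
  have h2 := stdNormalCDF_nonneg z
  have h3 := stdNormalCDF_le_one z
  unfold steinDeriv
  rw [abs_le]
  split_ifs <;> constructor <;> linarith

lemma abs_steinSol_sub_le (z u w : ℝ) : |steinSol z u - steinSol z w| ≤ 2 * |u - w| := by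
  wlog h : w ≤ u generalizing u w
  · rw [abs_sub_comm, abs_sub_comm u]; exact this w u (le_of_not_ge h)
  rw [abs_of_nonneg (sub_nonneg.2 h), abs_le]
  have hc := continuous_steinSol z
  constructor
  · have := sub_le_mul_of_deriv_le_off_point (K := 2) hc.neg h
      (fun u hu => (steinSol_hasDerivAt hu).neg)
      (fun u _ _ => by linarith [(abs_le.1 (abs_steinDeriv_le z u)).1])
    simp only [Pi.neg_apply] at this
    linarith
  · exact sub_le_mul_of_deriv_le_off_point hc h (fun u hu => steinSol_hasDerivAt hu)
      (fun u _ _ => (abs_le.1 (abs_steinDeriv_le z u)).2)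

lemma abs_mul_steinSol_sub_le (z u w : ℝ) :
    |u * steinSol z u - w * steinSol z w| ≤ |u - w| * (3 + 2 * |w|) := by
  have h : u * steinSol z u - w * steinSol z w =
      (u - w) * steinSol z u + w * (steinSol z u - steinSol z w) := by ring
  rw [h]
  refine (abs_add_le _ _).trans ?_
  rw [abs_mul, abs_mul, abs_of_nonneg (steinSol_nonneg z u)]
  have h1 := mul_le_mul_of_nonneg_left (steinSol_le z u) (abs_nonneg (u - w))
  have h2 := mul_le_mul_of_nonneg_left (abs_steinSol_sub_le z u w) (abs_nonneg w)
  nlinarith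

lemma steinSol_increment_le {z v w a δ : ℝ} (ha : 0 ≤ a) (haδ : a ≤ δ) (h1 : v ≤ w)
    (h2 : w ≤ v + a) : steinSol z (v + a) - steinSol z v ≤
      a * ((if w ≤ z + δ then 1 else 0) - stdNormalCDF z + w * steinSol z w
        + δ * (3 + 2 * |w|)) := by
  have := sub_le_mul_of_deriv_le_off_point (continuous_steinSol z)
    (a := v) (b := v + a) (by linarith) (fun u hu => steinSol_hasDerivAt hu)
    (K := (if w ≤ z + δ then 1 else 0) - stdNormalCDF z + w * steinSol z w
        + δ * (3 + 2 * |w|)) (fun u hu _ => ?_)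
  · linarith
  have h3 := (abs_le.1 (abs_mul_steinSol_sub_le z u w)).2
  have h4 : |u - w| ≤ δ := by rw [abs_le]; constructor <;> linarith [hu.1, hu.2]
  have h5 : |u - w| * (3 + 2 * |w|) ≤ δ * (3 + 2 * |w|) := by gcongr
  have h6 : (if u ≤ z then (1 : ℝ) else 0) ≤ if w ≤ z + δ then 1 else 0 := by
    have := hu.1
    split_ifs <;> first | (exfalso; linarith) | norm_num
  unfold steinDeriv
  linarith

lemma steinSol_increment_ge {z v w a δ : ℝ} (ha : 0 ≤ a) (haδ : a ≤ δ) (h1 : v ≤ w)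
    (h2 : w ≤ v + a) : a * ((if w ≤ z - δ then 1 else 0) - stdNormalCDF z + w * steinSol z w
        - δ * (3 + 2 * |w|)) ≤ steinSol z (v + a) - steinSol z v := by
  have := sub_le_mul_of_deriv_le_off_point (continuous_steinSol z).neg
    (a := v) (b := v + a) (by linarith) (fun u hu => (steinSol_hasDerivAt hu).neg)
    (K := -((if w ≤ z - δ then 1 else 0) - stdNormalCDF z + w * steinSol z w
        - δ * (3 + 2 * |w|))) (fun u hu _ => ?_)
  · simp only [Pi.neg_apply] at this
    linarith
  have h3 := (abs_le.1 (abs_mul_steinSol_sub_le z u w)).1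
  have h4 : |u - w| ≤ δ := by rw [abs_le]; constructor <;> linarith [hu.1, hu.2]
  have h5 : |u - w| * (3 + 2 * |w|) ≤ δ * (3 + 2 * |w|) := by gcongr
  have h6 : (if w ≤ z - δ then (1 : ℝ) else 0) ≤ if u ≤ z then 1 else 0 := by
    have := hu.2
    split_ifs <;> first | (exfalso; linarith) | norm_num
  unfold steinDeriv
  linarith

/-! ### Sums of independent weighted Bernoulli variables -/

/-- Expectation of a functional of the random subset of `s` that contains each `i ∈ s`
independently with probability `p i`. -/
def bernExp (p : ℕ → ℝ) (s : Finset ℕ) (h : Finset ℕ → ℝ) : ℝ :=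
  ∑ V ∈ s.powerset, (∏ i ∈ V, p i) * (∏ i ∈ s \ V, (1 - p i)) * h V

section Bernoulli

variable {p : ℕ → ℝ} {s : Finset ℕ}

lemma bernExp_insert {i : ℕ} (hi : i ∉ s) (h : Finset ℕ → ℝ) :
    bernExp p (insert i s) h =
      (1 - p i) * bernExp p s h + p i * bernExp p s (fun V => h (insert i V)) := by
  unfold bernExp
  rw [Finset.sum_powerset_insert hi, Finset.mul_sum, Finset.mul_sum]
  congr 1
  · refine Finset.sum_congr rfl fun V hV => ?_
    have hV' : V ⊆ s := Finset.mem_powerset.1 hV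
    have hiV : i ∉ V := fun h => hi (hV' h)
    rw [Finset.insert_sdiff_of_notMem _ hiV, Finset.prod_insert (by simp [hi])]
    ring
  · refine Finset.sum_congr rfl fun V hV => ?_
    have hV' : V ⊆ s := Finset.mem_powerset.1 hV
    have hiV : i ∉ V := fun h => hi (hV' h)
    have : insert i s \ insert i V = s \ V := by
      ext j; simp only [Finset.mem_sdiff, Finset.mem_insert]
      constructor
      · rintro ⟨h1 | h1, h2⟩ <;> tauto
      · rintro ⟨h1, h2⟩
        exact ⟨Or.inr h1, by rintro (rfl | h3); exacts [hi h1, h2 h3]⟩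
    rw [this, Finset.prod_insert hiV]
    ring

lemma bernExp_add (f g : Finset ℕ → ℝ) :
    bernExp p s (fun V => f V + g V) = bernExp p s f + bernExp p s g := by
  simp only [bernExp, mul_add, Finset.sum_add_distrib]

lemma bernExp_sub (f g : Finset ℕ → ℝ) :
    bernExp p s (fun V => f V - g V) = bernExp p s f - bernExp p s g := by
  simp only [bernExp, mul_sub, Finset.sum_sub_distrib]

lemma bernExp_const_mul (c : ℝ) (f : Finset ℕ → ℝ) :
    bernExp p s (fun V => c * f V) = c * bernExp p s f := by
  simp only [bernExp, Finset.mul_sum]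
  exact Finset.sum_congr rfl fun V _ => by ring

lemma bernExp_sum (t : Finset ℕ) (f : ℕ → Finset ℕ → ℝ) :
    bernExp p s (fun V => ∑ i ∈ t, f i V) = ∑ i ∈ t, bernExp p s (f i) := by
  simp only [bernExp, Finset.mul_sum]
  exact Finset.sum_comm

lemma bernExp_congr {f g : Finset ℕ → ℝ} (h : ∀ V ⊆ s, f V = g V) :
    bernExp p s f = bernExp p s g :=
  Finset.sum_congr rfl fun V hV => by rw [h V (Finset.mem_powerset.1 hV)]

lemma bernExp_const (c : ℝ) : bernExp p s (fun _ => c) = c := by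
  induction s using Finset.induction_on with
  | empty => simp [bernExp]
  | insert i s hi ih => rw [bernExp_insert hi, ih]; ring

lemma bernExp_mono (hp : ∀ i ∈ s, 0 ≤ p i ∧ p i ≤ 1) {f g : Finset ℕ → ℝ}
    (h : ∀ V ⊆ s, f V ≤ g V) : bernExp p s f ≤ bernExp p s g := by
  refine Finset.sum_le_sum fun V hV => ?_
  have hV' : V ⊆ s := Finset.mem_powerset.1 hV
  refine mul_le_mul_of_nonneg_left (h V hV') (mul_nonneg ?_ ?_)
  · exact Finset.prod_nonneg fun i hi => (hp i (hV' hi)).1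
  · exact Finset.prod_nonneg fun i hi => by linarith [(hp i (Finset.mem_sdiff.1 hi).1).2]

/-- Conditioning on the membership of one element. -/
lemma bernExp_split {i : ℕ} (hi : i ∈ s) (h : Finset ℕ → ℝ) :
    bernExp p s h = (1 - p i) * bernExp p s (fun V => h (V.erase i)) +
      p i * bernExp p s (fun V => h (insert i (V.erase i))) := by
  have key : ∀ g : Finset ℕ → ℝ,
      bernExp p s (fun V => g (V.erase i)) = bernExp p (s.erase i) g := by
    intro g
    rw [← Finset.insert_erase hi, bernExp_insert (Finset.notMem_erase i s)]
    simp only [Finset.erase_insert_eq_erase, Finset.erase_idem]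
    have : bernExp p (s.erase i) (fun V => g (V.erase i)) = bernExp p (s.erase i) g :=
      bernExp_congr fun V hV => by
        rw [Finset.erase_eq_of_notMem fun h => Finset.notMem_erase i s (hV h)]
    rw [this]; ring
  rw [key h, key (fun V => h (insert i V)), ← bernExp_insert (Finset.notMem_erase i s),
    Finset.insert_erase hi]

variable {a : ℕ → ℝ}

/-- The Stein identity for sums of independent Bernoulli variables. -/
lemma bernExp_stein (g : ℝ → ℝ) :
    bernExp p s (fun V => (∑ i ∈ V, a i - ∑ i ∈ s, p i * a i) * g (∑ i ∈ V, a i)) =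
      bernExp p s (fun V => ∑ i ∈ s, p i * (1 - p i) * a i *
        (g (∑ j ∈ V.erase i, a j + a i) - g (∑ j ∈ V.erase i, a j))) := by
  have h1 : bernExp p s (fun V => (∑ i ∈ V, a i - ∑ i ∈ s, p i * a i) * g (∑ i ∈ V, a i)) =
      bernExp p s (fun V => ∑ i ∈ s, ((if i ∈ V then 1 else 0) - p i) * a i *
        g (∑ i ∈ V, a i)) := by
    refine bernExp_congr fun V hV => ?_
    rw [← Finset.sum_mul]
    congr 1
    simp only [sub_mul, Finset.sum_sub_distrib, ite_mul, one_mul, zero_mul]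
    congr 1
    rw [← Finset.sum_filter, Finset.filter_mem_eq_inter, Finset.inter_eq_right.2 hV]
  rw [h1, bernExp_sum, bernExp_sum]
  refine Finset.sum_congr rfl fun i hi => ?_
  rw [bernExp_split hi]
  simp only [Finset.notMem_erase, if_false, Finset.mem_insert_self, if_true]
  rw [← bernExp_const_mul, ← bernExp_const_mul, ← bernExp_add]
  refine bernExp_congr fun V _ => ?_
  rw [Finset.sum_insert (Finset.notMem_erase i V), add_comm (a i)]
  ring

/-- A Berry-Esseen bound for normalised sums of bounded independent Bernoulli variables. -/
theorem bernExp_berryEsseen_normalized {δ : ℝ} (hδ : 0 ≤ δ)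
    (hp : ∀ i ∈ s, 0 ≤ p i ∧ p i ≤ 1) (ha : ∀ i ∈ s, 0 ≤ a i ∧ a i ≤ δ)
    (hv : ∑ i ∈ s, p i * (1 - p i) * a i ^ 2 = 1) (z : ℝ) :
    |bernExp p s (fun V => if ∑ i ∈ V, a i - ∑ i ∈ s, p i * a i ≤ z then 1 else 0) -
      stdNormalCDF z| ≤ 6 * δ := by
  set m := ∑ i ∈ s, p i * a i with hm
  have hvar : bernExp p s (fun V => (∑ i ∈ V, a i - m) * (∑ i ∈ V, a i - m)) = 1 := by
    rw [bernExp_stein (fun x => x - m)]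
    refine Eq.trans (bernExp_congr fun V _ => ?_) (bernExp_const (p := p) (s := s) (1 : ℝ))
    refine Eq.trans ?_ hv
    exact Finset.sum_congr rfl fun i _ => by ring
  have habs : bernExp p s (fun V => |∑ i ∈ V, a i - m|) ≤ 1 := by
    have : bernExp p s (fun V => |∑ i ∈ V, a i - m|) ≤
        bernExp p s (fun V => (1 / 2) * (1 + (∑ i ∈ V, a i - m) * (∑ i ∈ V, a i - m))) := by
      refine bernExp_mono hp fun V _ => ?_
      have := abs_mul_abs_self (∑ i ∈ V, a i - m)
      nlinarith [sq_nonneg (|∑ i ∈ V, a i - m| - 1)]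
    rw [bernExp_const_mul, bernExp_add, bernExp_const, hvar] at this
    linarith
  have hpos : ∀ i ∈ s, 0 ≤ p i * (1 - p i) * a i := fun i hi =>
    mul_nonneg (mul_nonneg (hp i hi).1 (by linarith [(hp i hi).2])) (ha i hi).1
  have hmem : ∀ V ⊆ s, ∀ i ∈ s, ∑ j ∈ V.erase i, a j ≤ ∑ j ∈ V, a j ∧
      ∑ j ∈ V, a j ≤ ∑ j ∈ V.erase i, a j + a i := by
    intro V _ i hi
    by_cases h : i ∈ V
    · rw [← Finset.sum_erase_add _ _ h]
      exact ⟨by linarith [(ha i hi).1], le_rfl⟩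
    · rw [Finset.erase_eq_of_notMem h]
      exact ⟨le_rfl, by linarith [(ha i hi).1]⟩
  have hupper : ∀ z, stdNormalCDF z ≤
      bernExp p s (fun V => if ∑ i ∈ V, a i - m ≤ z + δ then 1 else 0) + 5 * δ := by
    intro z
    have hst := bernExp_stein (p := p) (s := s) (a := a) (fun x => steinSol z (x - m))
    have hle : bernExp p s (fun V => ∑ i ∈ s, p i * (1 - p i) * a i *
        (steinSol z (∑ j ∈ V.erase i, a j + a i - m) - steinSol z (∑ j ∈ V.erase i, a j - m))) ≤
        bernExp p s (fun V => ((if ∑ i ∈ V, a i - m ≤ z + δ then 1 else 0) - stdNormalCDF z) +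
          (∑ i ∈ V, a i - m) * steinSol z (∑ i ∈ V, a i - m) +
            (δ * 3 + (δ * 2) * |∑ i ∈ V, a i - m|)) := by
      refine bernExp_mono hp fun V hV => ?_
      calc _ ≤ ∑ i ∈ s, p i * (1 - p i) * a i * (a i *
            ((if ∑ i ∈ V, a i - m ≤ z + δ then 1 else 0) - stdNormalCDF z +
              (∑ i ∈ V, a i - m) * steinSol z (∑ i ∈ V, a i - m) +
              δ * (3 + 2 * |∑ i ∈ V, a i - m|))) := by
            refine Finset.sum_le_sum fun i hi => mul_le_mul_of_nonneg_left ?_ (hpos i hi)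
            have := hmem V hV i hi
            have h := steinSol_increment_le (z := z) (v := ∑ j ∈ V.erase i, a j - m)
              (w := ∑ i ∈ V, a i - m) (ha i hi).1 (ha i hi).2 (by linarith) (by linarith)
            rwa [sub_add_eq_add_sub] at h
        _ = (∑ i ∈ s, p i * (1 - p i) * a i ^ 2) *
            ((if ∑ i ∈ V, a i - m ≤ z + δ then 1 else 0) - stdNormalCDF z +
              (∑ i ∈ V, a i - m) * steinSol z (∑ i ∈ V, a i - m) +
              δ * (3 + 2 * |∑ i ∈ V, a i - m|)) := by
            rw [Finset.sum_mul]; exact Finset.sum_congr rfl fun i _ => by ring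
        _ = _ := by rw [hv]; ring
    rw [← hst, bernExp_add, bernExp_add, bernExp_sub, bernExp_const, bernExp_add, bernExp_const,
      bernExp_const_mul] at hle
    nlinarith
  have hlower : ∀ z, bernExp p s (fun V => if ∑ i ∈ V, a i - m ≤ z - δ then 1 else 0) - 5 * δ ≤
      stdNormalCDF z := by
    intro z
    have hst := bernExp_stein (p := p) (s := s) (a := a) (fun x => steinSol z (x - m))
    have hle : bernExp p s (fun V => ((if ∑ i ∈ V, a i - m ≤ z - δ then 1 else 0) -
          stdNormalCDF z) + (∑ i ∈ V, a i - m) * steinSol z (∑ i ∈ V, a i - m) -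
            (δ * 3 + (δ * 2) * |∑ i ∈ V, a i - m|)) ≤
        bernExp p s (fun V => ∑ i ∈ s, p i * (1 - p i) * a i *
        (steinSol z (∑ j ∈ V.erase i, a j + a i - m) -
          steinSol z (∑ j ∈ V.erase i, a j - m))) := by
      refine bernExp_mono hp fun V hV => ?_
      calc _ = (∑ i ∈ s, p i * (1 - p i) * a i ^ 2) *
            ((if ∑ i ∈ V, a i - m ≤ z - δ then 1 else 0) - stdNormalCDF z +
              (∑ i ∈ V, a i - m) * steinSol z (∑ i ∈ V, a i - m) -
              δ * (3 + 2 * |∑ i ∈ V, a i - m|)) := by rw [hv]; ring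
        _ = ∑ i ∈ s, p i * (1 - p i) * a i * (a i *
            ((if ∑ i ∈ V, a i - m ≤ z - δ then 1 else 0) - stdNormalCDF z +
              (∑ i ∈ V, a i - m) * steinSol z (∑ i ∈ V, a i - m) -
              δ * (3 + 2 * |∑ i ∈ V, a i - m|))) := by
            rw [Finset.sum_mul]; exact Finset.sum_congr rfl fun i _ => by ring
        _ ≤ _ := by
            refine Finset.sum_le_sum fun i hi => mul_le_mul_of_nonneg_left ?_ (hpos i hi)
            have := hmem V hV i hi
            have h := steinSol_increment_ge (z := z) (v := ∑ j ∈ V.erase i, a j - m)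
              (w := ∑ i ∈ V, a i - m) (ha i hi).1 (ha i hi).2 (by linarith) (by linarith)
            rwa [sub_add_eq_add_sub (∑ j ∈ V.erase i, a j)] at h
    rw [← hst, bernExp_sub, bernExp_add, bernExp_sub, bernExp_const, bernExp_add, bernExp_const,
      bernExp_const_mul] at hle
    nlinarith
  have h1 := hupper (z - δ)
  have h2 := hlower (z + δ)
  rw [sub_add_cancel] at h1
  rw [add_sub_cancel_right] at h2
  have h3 := (abs_le.1 (abs_stdNormalCDF_sub_le z (z - δ))).1
  have h4 := (abs_le.1 (abs_stdNormalCDF_sub_le z (z + δ))).2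
  rw [sub_sub_cancel_left, abs_neg, abs_of_nonneg hδ] at h3
  rw [add_sub_cancel_left, abs_of_nonneg hδ] at h4
  rw [abs_le]
  constructor <;> linarith

/-- A Berry-Esseen bound for sums of bounded independent Bernoulli variables. -/
theorem bernExp_berryEsseen {D σ : ℝ} (hσ : 0 < σ)
    (hp : ∀ i ∈ s, 0 ≤ p i ∧ p i ≤ 1) (hD : 0 ≤ D) (ha : ∀ i ∈ s, 0 ≤ a i ∧ a i ≤ D)
    (hv : ∑ i ∈ s, p i * (1 - p i) * a i ^ 2 = σ ^ 2) (y : ℝ) :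
    |bernExp p s (fun V => if ∑ i ∈ V, a i ≤ y then 1 else 0) -
      stdNormalCDF ((y - ∑ i ∈ s, p i * a i) / σ)| ≤ 6 * (D / σ) := by
  have h := bernExp_berryEsseen_normalized (p := p) (s := s) (a := fun i => a i / σ)
    (δ := D / σ) (by positivity) hp
    (fun i hi => ⟨div_nonneg (ha i hi).1 hσ.le, div_le_div_of_nonneg_right (ha i hi).2 hσ.le⟩)
    (by
      have : ∑ i ∈ s, p i * (1 - p i) * (a i / σ) ^ 2 =
          (∑ i ∈ s, p i * (1 - p i) * a i ^ 2) / σ ^ 2 := by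
        rw [Finset.sum_div]; exact Finset.sum_congr rfl fun i _ => by ring
      rw [this, hv, div_self (by positivity)])
    ((y - ∑ i ∈ s, p i * a i) / σ)
  convert h using 5 with V
  have : ∑ i ∈ V, a i / σ - ∑ i ∈ s, p i * (a i / σ) =
      (∑ i ∈ V, a i - ∑ i ∈ s, p i * a i) / σ := by
    rw [sub_div, Finset.sum_div, Finset.sum_div]
    congr 1
    exact Finset.sum_congr rfl fun i _ => by ring
  simp only [this, div_le_div_iff_of_pos_right hσ, sub_le_sub_iff_right]

end Bernoulli

/-! ### The cycle lengths of a random permutation as a Markov chain -/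

/-- Expectation of a functional of the list of pairs (number of remaining points, length of the next
cycle) produced when the cycles of a uniform random permutation of `m` points are removed one by
one: the length of the next cycle is uniform on `{1, …, m}`. -/
def cycExp : ℕ → (List (ℕ × ℕ) → ℝ) → ℝ
  | 0, F => F []
  | m + 1, F => (∑ j : Fin (m + 1), cycExp j (fun L => F ((m + 1, m + 1 - j) :: L))) / (m + 1)

lemma cycExp_zero (F : List (ℕ × ℕ) → ℝ) : cycExp 0 F = F [] := by rw [cycExp]

lemma cycExp_succ (m : ℕ) (F : List (ℕ × ℕ) → ℝ) : cycExp (m + 1) F =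
    (∑ j ∈ Finset.range (m + 1), cycExp j (fun L => F ((m + 1, m + 1 - j) :: L))) / (m + 1) := by
  rw [cycExp, Finset.sum_range]

/-- The pairs that can occur in the chain started from `m`. -/
def ValidList (m : ℕ) (L : List (ℕ × ℕ)) : Prop :=
  ∀ x ∈ L, 1 ≤ x.2 ∧ x.2 ≤ x.1 ∧ x.1 ≤ m

lemma cycExp_mono {m : ℕ} {F G : List (ℕ × ℕ) → ℝ} (h : ∀ L, ValidList m L → F L ≤ G L) :
    cycExp m F ≤ cycExp m G := by
  induction m using Nat.strong_induction_on generalizing F G with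
  | _ m ih =>
    cases m with
    | zero =>
      rw [cycExp_zero, cycExp_zero]
      exact h _ (by simp [ValidList])
    | succ m =>
      rw [cycExp_succ, cycExp_succ]
      gcongr with j hj
      have hj := Finset.mem_range.1 hj
      refine ih j hj fun L hL => h _ ?_
      intro x hx
      rcases List.mem_cons.1 hx with rfl | hx
      · exact ⟨by simp only; omega, by simp only; omega, le_rfl⟩
      · have := hL x hx
        exact ⟨this.1, this.2.1, by omega⟩

lemma cycExp_congr {m : ℕ} {F G : List (ℕ × ℕ) → ℝ} (h : ∀ L, ValidList m L → F L = G L) :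
    cycExp m F = cycExp m G :=
  le_antisymm (cycExp_mono fun L hL => (h L hL).le) (cycExp_mono fun L hL => (h L hL).ge)

lemma cycExp_add (m : ℕ) (F G : List (ℕ × ℕ) → ℝ) :
    cycExp m (fun L => F L + G L) = cycExp m F + cycExp m G := by
  induction m using Nat.strong_induction_on generalizing F G with
  | _ m ih =>
    cases m with
    | zero => simp only [cycExp_zero]
    | succ m =>
      simp only [cycExp_succ]
      rw [← add_div, ← Finset.sum_add_distrib]
      congr 1
      exact Finset.sum_congr rfl fun j hj => ih j (Finset.mem_range.1 hj) _ _

lemma cycExp_const_mul (m : ℕ) (c : ℝ) (F : List (ℕ × ℕ) → ℝ) :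
    cycExp m (fun L => c * F L) = c * cycExp m F := by
  induction m using Nat.strong_induction_on generalizing F with
  | _ m ih =>
    cases m with
    | zero => simp only [cycExp_zero]
    | succ m =>
      simp only [cycExp_succ]
      rw [← mul_div_assoc, Finset.mul_sum]
      congr 1
      exact Finset.sum_congr rfl fun j hj => ih j (Finset.mem_range.1 hj) _

lemma cycExp_sum (m : ℕ) (s : Finset ℕ) (F : ℕ → List (ℕ × ℕ) → ℝ) :
    cycExp m (fun L => ∑ i ∈ s, F i L) = ∑ i ∈ s, cycExp m (F i) := by
  induction s using Finset.induction_on with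
  | empty => simpa using cycExp_const_mul m 0 (fun _ => 0)
  | insert i s hi ih => simp only [Finset.sum_insert hi, cycExp_add, ih]

lemma cycExp_const (m : ℕ) (c : ℝ) : cycExp m (fun _ => c) = c := by
  induction m using Nat.strong_induction_on with
  | _ m ih =>
    cases m with
    | zero => rw [cycExp_zero]
    | succ m =>
      rw [cycExp_succ, Finset.sum_congr rfl fun j hj => ih j (Finset.mem_range.1 hj)]
      rw [Finset.sum_const, Finset.card_range, nsmul_eq_mul]
      push_cast
      field_simp

lemma cycExp_nonneg {m : ℕ} {F : List (ℕ × ℕ) → ℝ} (h : ∀ L, ValidList m L → 0 ≤ F L) :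
    0 ≤ cycExp m F := by
  rw [← cycExp_const m 0]; exact cycExp_mono h

/-- The harmonic numbers as real numbers. -/
def harm (m : ℕ) : ℝ := ∑ i ∈ Finset.range m, (1 : ℝ) / (i + 1)

lemma harm_succ (m : ℕ) : harm (m + 1) = harm m + 1 / (m + 1) := Finset.sum_range_succ _ _

lemma harm_nonneg (m : ℕ) : 0 ≤ harm m := Finset.sum_nonneg fun i _ => by positivity

lemma harm_mono : Monotone harm :=
  monotone_nat_of_le_succ fun m => by rw [harm_succ]; linarith [show (0 : ℝ) ≤ 1 / (m + 1) by positivity]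

lemma harm_le (m : ℕ) : harm m ≤ 1 + Real.log m := by
  have h := harmonic_le_one_add_log m
  have : harm m = (harmonic m : ℝ) := by
    unfold harm harmonic; push_cast; simp
  rwa [this]

lemma sum_harm (m : ℕ) : ∑ j ∈ Finset.range (m + 1), harm j = (m + 1) * (harm (m + 1) - 1) := by
  induction m with
  | zero => simp [harm]
  | succ m ih =>
    rw [Finset.sum_range_succ, ih, harm_succ (m + 1)]
    push_cast
    field_simp
    ring

/-- A recursive inequality of renewal type is controlled by the harmonic numbers. -/
lemma le_mul_harm_of_rec {a : ℕ → ℝ} {c : ℝ} {M : ℕ} (h0 : a 0 ≤ 0)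
    (h : ∀ m < M, a (m + 1) ≤ c + (∑ j ∈ Finset.range (m + 1), a j) / (m + 1)) :
    ∀ m ≤ M, a m ≤ c * harm m := by
  intro m
  induction m using Nat.strong_induction_on with
  | _ m ih =>
    intro hm
    cases m with
    | zero => simpa [harm] using h0
    | succ m =>
      refine (h m (by omega)).trans ?_
      have h1 : ∑ j ∈ Finset.range (m + 1), a j ≤ c * ((m + 1) * (harm (m + 1) - 1)) := by
        rw [← sum_harm, Finset.mul_sum]
        refine Finset.sum_le_sum fun j hj => ?_
        have := Finset.mem_range.1 hj
        exact ih j this (by omega)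
      have h2 : (∑ j ∈ Finset.range (m + 1), a j) / (m + 1) ≤ c * (harm (m + 1) - 1) := by
        rw [div_le_iff₀ (by positivity)]
        linarith
      linarith

/-- The sum of the logarithms of the states visited by the chain. -/
def stateLog (L : List (ℕ × ℕ)) : ℝ := (L.map fun x => Real.log x.1).sum

/-- The sum of the logarithms of the cycle lengths. -/
def gapLog (L : List (ℕ × ℕ)) : ℝ := (L.map fun x => Real.log x.2).sum

/-- The number of cycles whose length is divisible by `d`. -/
def gapCount (d : ℕ) (L : List (ℕ × ℕ)) : ℕ := L.countP fun x => d ∣ x.2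

/-- The least common multiple of the cycle lengths. -/
def gapLcm (L : List (ℕ × ℕ)) : ℕ := ((L.map Prod.snd : List ℕ) : Multiset ℕ).lcm

lemma average_bernExp (h : ℝ → ℝ) (m : ℕ) :
    (∑ j ∈ Finset.range (m + 1), cycExp j (fun L => h (stateLog L))) / (m + 1) =
      bernExp (fun i => 1 / ((i : ℝ) + 1)) (Finset.range (m + 1))
        (fun V => h (∑ i ∈ V, Real.log i)) := by
  induction m generalizing h with
  | zero =>
    rw [Finset.range_add_one, bernExp_insert (by simp)]
    simp [bernExp, cycExp_zero, stateLog]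
  | succ m ih =>
    rw [Finset.range_add_one (n := m + 1), bernExp_insert (by simp),
      Finset.sum_insert (by simp), ← ih]
    have h1 : bernExp (fun i => 1 / ((i : ℝ) + 1)) (Finset.range (m + 1))
        (fun V => h (∑ i ∈ insert (m + 1) V, Real.log i)) =
        cycExp (m + 1) (fun L => h (stateLog L)) := by
      rw [cycExp_succ]
      have := ih (fun x => h (Real.log ((m + 1 : ℕ) : ℝ) + x))
      simp only [stateLog, List.map_cons, List.sum_cons]
      simp only [stateLog] at this
      rw [this]
      refine bernExp_congr fun V hV => ?_
      rw [Finset.sum_insert (fun h => by simpa using hV h)]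
    rw [h1]
    push_cast
    field_simp
    ring

/-- The sum of logarithms of the visited states is a sum of independent variables. -/
lemma cycExp_stateLog (h : ℝ → ℝ) (m : ℕ) :
    cycExp (m + 1) (fun L => h (stateLog L)) =
      bernExp (fun i => 1 / ((i : ℝ) + 1)) (Finset.range (m + 1))
        (fun V => h (Real.log (m + 1) + ∑ i ∈ V, Real.log i)) := by
  rw [← average_bernExp (fun x => h (Real.log (m + 1) + x)), cycExp_succ]
  simp [stateLog]

lemma mul_log_sub_log_factorial_le (m : ℕ) :
    (m : ℝ) * Real.log m - Real.log (m.factorial) ≤ m := by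
  rcases Nat.eq_zero_or_pos m with rfl | hm
  · simp
  have h := Real.pow_div_factorial_le_exp (m : ℝ) (by positivity) m
  have h2 := Real.log_le_log (by positivity) h
  rw [Real.log_exp, Real.log_div (by positivity) (by positivity), Real.log_pow] at h2
  exact h2

lemma cycExp_stateLog_sub_gapLog_le (m : ℕ) :
    cycExp m (fun L => stateLog L - gapLog L) ≤ harm m := by
  have := le_mul_harm_of_rec (a := fun m => cycExp m (fun L => stateLog L - gapLog L)) (c := 1)
    (M := m) (by simp [cycExp_zero, stateLog, gapLog]) (fun m _ => ?_) m le_rfl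
  · simpa using this
  rw [cycExp_succ]
  have h1 : ∀ j ∈ Finset.range (m + 1), cycExp j (fun L => stateLog ((m + 1, m + 1 - j) :: L) -
      gapLog ((m + 1, m + 1 - j) :: L)) =
      (Real.log (m + 1 : ℕ) - Real.log ((m + 1 - j : ℕ) : ℝ)) +
        cycExp j (fun L => stateLog L - gapLog L) := by
    intro j _
    conv_rhs => rw [← cycExp_const j (Real.log (m + 1 : ℕ) - Real.log ((m + 1 - j : ℕ) : ℝ))]
    rw [← cycExp_add]
    refine cycExp_congr fun L _ => ?_
    simp only [stateLog, gapLog, List.map_cons, List.sum_cons]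
    ring
  rw [Finset.sum_congr rfl h1, Finset.sum_add_distrib, add_div]
  gcongr
  rw [div_le_one (by positivity)]
  have h2 : ∑ j ∈ Finset.range (m + 1), Real.log ((m + 1 - j : ℕ) : ℝ) =
      Real.log ((m + 1).factorial) := by
    rw [← Finset.prod_range_add_one_eq_factorial]
    push_cast
    rw [Real.log_prod (fun i _ => by positivity), ← Finset.sum_range_reflect]
    refine Finset.sum_congr rfl fun j hj => ?_
    have := Finset.mem_range.1 hj
    have h3 : m + 1 - (m + 1 - 1 - j) = j + 1 := by omega
    rw [h3]; push_cast; rfl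
  rw [Finset.sum_sub_distrib, h2, Finset.sum_const, Finset.card_range, nsmul_eq_mul]
  have := mul_log_sub_log_factorial_le (m + 1)
  push_cast at this ⊢
  exact this

lemma gapCount_cons (d : ℕ) (x : ℕ × ℕ) (L : List (ℕ × ℕ)) :
    gapCount d (x :: L) = gapCount d L + if d ∣ x.2 then 1 else 0 := by
  simp [gapCount, List.countP_cons]

lemma average_dvd_le {d : ℕ} (hd : 0 < d) (m : ℕ) :
    (∑ j ∈ Finset.range (m + 1), if d ∣ m + 1 - j then (1 : ℝ) else 0) / (m + 1) ≤ 1 / d := by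
  have h1 : ∑ j ∈ Finset.range (m + 1), (if d ∣ m + 1 - j then (1 : ℝ) else 0) =
      ((m + 1) / d : ℕ) := by
    rw [← Nat.card_multiples, ← Finset.sum_range_reflect, Finset.card_filter]
    push_cast
    refine Finset.sum_congr rfl fun j hj => ?_
    have := Finset.mem_range.1 hj
    have h3 : m + 1 - (m - j) = j + 1 := by omega
    rw [h3]
  rw [h1, div_le_div_iff₀ (by positivity) (by positivity), one_mul]
  exact_mod_cast Nat.div_mul_le_self (m + 1) d

lemma cycExp_gapCount_le {d : ℕ} (hd : 0 < d) (m : ℕ) :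
    cycExp m (fun L => (gapCount d L : ℝ)) ≤ 1 / d * harm m := by
  refine le_mul_harm_of_rec (a := fun m => cycExp m (fun L => (gapCount d L : ℝ)))
    (M := m) (by simp [cycExp_zero, gapCount]) (fun m _ => ?_) m le_rfl
  rw [cycExp_succ]
  have h1 : ∀ j ∈ Finset.range (m + 1),
      cycExp j (fun L => (gapCount d ((m + 1, m + 1 - j) :: L) : ℝ)) =
      (if d ∣ m + 1 - j then (1 : ℝ) else 0) + cycExp j (fun L => (gapCount d L : ℝ)) := by
    intro j _
    conv_rhs => rw [← cycExp_const j (if d ∣ m + 1 - j then (1 : ℝ) else 0)]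
    rw [← cycExp_add]
    refine cycExp_congr fun L _ => ?_
    rw [gapCount_cons]; push_cast; ring
  rw [Finset.sum_congr rfl h1, Finset.sum_add_distrib, add_div]
  exact add_le_add_left (average_dvd_le hd m) _

lemma cycExp_gapCount_pairs_le {d : ℕ} (hd : 0 < d) (M : ℕ) :
    cycExp M (fun L => (gapCount d L : ℝ) * ((gapCount d L : ℝ) - 1)) ≤
      2 * (harm M / d) ^ 2 := by
  have := le_mul_harm_of_rec
    (a := fun m => cycExp m (fun L => (gapCount d L : ℝ) * ((gapCount d L : ℝ) - 1)))
    (M := M) (c := 2 * (1 / d * (1 / d * harm M)))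
    (by simp [cycExp_zero, gapCount]) (fun m hm => ?_) M le_rfl
  · refine this.trans (le_of_eq ?_)
    ring
  rw [cycExp_succ]
  have h1 : ∀ j ∈ Finset.range (m + 1),
      cycExp j (fun L => (gapCount d ((m + 1, m + 1 - j) :: L) : ℝ) *
        ((gapCount d ((m + 1, m + 1 - j) :: L) : ℝ) - 1)) ≤
      (2 * (1 / d * harm M)) * (if d ∣ m + 1 - j then (1 : ℝ) else 0) +
        cycExp j (fun L => (gapCount d L : ℝ) * ((gapCount d L : ℝ) - 1)) := by
    intro j hj
    have hj := Finset.mem_range.1 hj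
    have h2 : cycExp j (fun L => (gapCount d ((m + 1, m + 1 - j) :: L) : ℝ) *
        ((gapCount d ((m + 1, m + 1 - j) :: L) : ℝ) - 1)) =
        (2 * if d ∣ m + 1 - j then (1 : ℝ) else 0) * cycExp j (fun L => (gapCount d L : ℝ)) +
          cycExp j (fun L => (gapCount d L : ℝ) * ((gapCount d L : ℝ) - 1)) := by
      rw [← cycExp_const_mul, ← cycExp_add]
      refine cycExp_congr fun L _ => ?_
      rw [gapCount_cons]
      split_ifs <;> push_cast <;> ring
    have h3 : cycExp j (fun L => (gapCount d L : ℝ)) ≤ 1 / d * harm M :=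
      (cycExp_gapCount_le hd j).trans (by gcongr; exact harm_mono (by omega))
    rw [h2]
    have h4 : (0 : ℝ) ≤ 2 * if d ∣ m + 1 - j then (1 : ℝ) else 0 := by split_ifs <;> norm_num
    have := mul_le_mul_of_nonneg_left h3 h4
    linarith
  have h5 : ∑ j ∈ Finset.range (m + 1), cycExp j
      (fun L => (gapCount d ((m + 1, m + 1 - j) :: L) : ℝ) *
        ((gapCount d ((m + 1, m + 1 - j) :: L) : ℝ) - 1)) ≤ _ := Finset.sum_le_sum h1
  rw [Finset.sum_add_distrib, ← Finset.mul_sum] at h5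
  refine (div_le_div_of_nonneg_right h5 (by positivity)).trans ?_
  rw [add_div, mul_div_assoc]
  refine add_le_add_left ?_ _
  have h6 : (0 : ℝ) ≤ 2 * (1 / d * harm M) := by have := harm_nonneg M; positivity
  have := mul_le_mul_of_nonneg_left (average_dvd_le hd m) h6
  linarith

lemma cycExp_gapCount_sq_le {d : ℕ} (hd : 0 < d) (m : ℕ) :
    cycExp m (fun L => (gapCount d L : ℝ) ^ 2) ≤ 2 * (harm m / d) ^ 2 + harm m / d := by
  have h : cycExp m (fun L => (gapCount d L : ℝ) ^ 2) =
      cycExp m (fun L => (gapCount d L : ℝ) * ((gapCount d L : ℝ) - 1)) +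
        cycExp m (fun L => (gapCount d L : ℝ)) := by
    rw [← cycExp_add]; congr 1; funext L; ring
  rw [h]
  have h1 := cycExp_gapCount_pairs_le hd m
  have h2 := cycExp_gapCount_le hd m
  have h3 : 1 / (d : ℝ) * harm m = harm m / d := by ring
  linarith

/-! ### Comparing the product and the least common multiple of the cycle lengths -/

open ArithmeticFunction in
lemma log_eq_sum_vonMangoldt_of_le {l M : ℕ} (h1 : 1 ≤ l) (h2 : l ≤ M) :
    Real.log l = ∑ d ∈ Finset.Icc 1 M, if d ∣ l then vonMangoldt d else 0 := by
  rw [← vonMangoldt_sum, ← Finset.sum_filter]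
  refine Finset.sum_congr ?_ fun _ _ => rfl
  ext d
  simp only [Nat.mem_divisors, Finset.mem_filter, Finset.mem_Icc]
  constructor
  · rintro ⟨h, _⟩
    exact ⟨⟨Nat.pos_of_dvd_of_pos h h1, (Nat.le_of_dvd h1 h).trans h2⟩, h⟩
  · rintro ⟨_, h⟩
    exact ⟨h, by omega⟩

lemma ValidList.tail {M : ℕ} {x : ℕ × ℕ} {L : List (ℕ × ℕ)} (h : ValidList M (x :: L)) :
    ValidList M L := fun y hy => h y (List.mem_cons_of_mem _ hy)

open ArithmeticFunction in
lemma gapLog_eq_sum {M : ℕ} {L : List (ℕ × ℕ)} (h : ValidList M L) :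
    gapLog L = ∑ d ∈ Finset.Icc 1 M, vonMangoldt d * gapCount d L := by
  induction L with
  | nil => simp [gapLog, gapCount]
  | cons x L ih =>
    have h1 := h x List.mem_cons_self
    have h2 := ih h.tail
    have h3 : gapLog (x :: L) = Real.log x.2 + gapLog L := by simp [gapLog]
    rw [h3, h2, log_eq_sum_vonMangoldt_of_le h1.1 (h1.2.1.trans h1.2.2), ← Finset.sum_add_distrib]
    refine Finset.sum_congr rfl fun d _ => ?_
    rw [gapCount_cons]
    split_ifs <;> push_cast <;> ring

lemma gapLcm_cons (x : ℕ × ℕ) (L : List (ℕ × ℕ)) :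
    gapLcm (x :: L) = Nat.lcm x.2 (gapLcm L) := by
  unfold gapLcm
  rw [List.map_cons, ← Multiset.cons_coe, Multiset.lcm_cons]
  rfl

lemma gapLcm_pos {M : ℕ} {L : List (ℕ × ℕ)} (h : ValidList M L) : 0 < gapLcm L := by
  induction L with
  | nil => simp [gapLcm]
  | cons x L ih =>
    rw [gapLcm_cons]
    exact Nat.lcm_pos (h x List.mem_cons_self).1 (ih h.tail)

lemma log_gapLcm_le_gapLog {M : ℕ} {L : List (ℕ × ℕ)} (h : ValidList M L) :
    Real.log (gapLcm L) ≤ gapLog L := by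
  induction L with
  | nil => simp [gapLcm, gapLog]
  | cons x L ih =>
    have hx := (h x List.mem_cons_self).1
    have hL := gapLcm_pos h.tail
    have h3 : gapLog (x :: L) = Real.log x.2 + gapLog L := by simp [gapLog]
    rw [gapLcm_cons, h3]
    have h4 : Nat.lcm x.2 (gapLcm L) ≤ x.2 * gapLcm L :=
      Nat.le_of_dvd (Nat.mul_pos hx hL) (Nat.lcm_dvd_mul _ _)
    have h5 : Real.log (Nat.lcm x.2 (gapLcm L) : ℕ) ≤ Real.log ((x.2 * gapLcm L : ℕ) : ℝ) :=
      Real.log_le_log (by exact_mod_cast Nat.lcm_pos hx hL) (by exact_mod_cast h4)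
    rw [Nat.cast_mul, Real.log_mul (by positivity) (by positivity)] at h5
    linarith [ih h.tail]

lemma gapLog_le_stateLog {M : ℕ} {L : List (ℕ × ℕ)} (h : ValidList M L) :
    gapLog L ≤ stateLog L := by
  induction L with
  | nil => simp [gapLog, stateLog]
  | cons x L ih =>
    have hx := h x List.mem_cons_self
    have := ih h.tail
    simp only [gapLog, stateLog, List.map_cons, List.sum_cons] at this ⊢
    gcongr
    · exact_mod_cast hx.1
    · exact hx.2.1

lemma dvd_gapLcm_of_gapCount_ne_zero {d : ℕ} {L : List (ℕ × ℕ)} (h : gapCount d L ≠ 0) :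
    d ∣ gapLcm L := by
  obtain ⟨x, hx, hd⟩ := List.countP_pos_iff.1 (Nat.pos_of_ne_zero h)
  refine (of_decide_eq_true hd).trans (Multiset.dvd_lcm ?_)
  simpa using ⟨x.1, hx⟩

open ArithmeticFunction in
lemma sum_vonMangoldt_le_log_gapLcm {M : ℕ} {L : List (ℕ × ℕ)} (h : ValidList M L) :
    ∑ d ∈ Finset.Icc 1 M, vonMangoldt d * (if gapCount d L = 0 then 0 else 1) ≤
      Real.log (gapLcm L) := by
  rw [← vonMangoldt_sum]
  simp only [mul_ite, mul_zero, mul_one]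
  rw [Finset.sum_ite, Finset.sum_const_zero, zero_add]
  refine Finset.sum_le_sum_of_subset_of_nonneg ?_ fun _ _ _ => vonMangoldt_nonneg
  intro d hd
  rw [Nat.mem_divisors]
  exact ⟨dvd_gapLcm_of_gapCount_ne_zero (Finset.mem_filter.1 hd).2, (gapLcm_pos h).ne'⟩

open ArithmeticFunction in
lemma gapLog_sub_log_gapLcm_le {M : ℕ} (Y : ℕ) {L : List (ℕ × ℕ)} (h : ValidList M L) :
    gapLog L - Real.log (gapLcm L) ≤
      ∑ d ∈ Finset.Icc 1 Y, vonMangoldt d * gapCount d L +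
      ∑ d ∈ Finset.Ioc Y M, vonMangoldt d * ((gapCount d L : ℝ) * ((gapCount d L : ℝ) - 1)) := by
  have hsq : ∀ d, (0 : ℝ) ≤ (gapCount d L : ℝ) * ((gapCount d L : ℝ) - 1) := by
    intro d
    rcases Nat.eq_zero_or_pos (gapCount d L) with h0 | h0
    · simp [h0]
    · have : (1 : ℝ) ≤ gapCount d L := by exact_mod_cast h0
      exact mul_nonneg (by linarith) (by linarith)
  have h1 := sum_vonMangoldt_le_log_gapLcm h
  rw [gapLog_eq_sum h]
  refine (sub_le_sub_left h1 _).trans ?_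
  rw [← Finset.sum_sub_distrib]
  have h2 : ∀ d ∈ Finset.Icc 1 M, vonMangoldt d * (gapCount d L : ℝ) -
      vonMangoldt d * (if gapCount d L = 0 then 0 else 1) ≤
      (if d ≤ Y then vonMangoldt d * (gapCount d L : ℝ) else 0) +
      (if Y < d then vonMangoldt d * ((gapCount d L : ℝ) * ((gapCount d L : ℝ) - 1)) else 0) := by
    intro d _
    have hΛ : 0 ≤ vonMangoldt d := vonMangoldt_nonneg
    by_cases hY : d ≤ Y
    · rw [if_pos hY, if_neg (not_lt.2 hY)]
      have : 0 ≤ vonMangoldt d * (if gapCount d L = 0 then (0 : ℝ) else 1) :=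
        mul_nonneg hΛ (by split_ifs <;> norm_num)
      linarith
    · rw [if_neg hY, if_pos (not_le.1 hY), zero_add, ← mul_sub]
      refine mul_le_mul_of_nonneg_left ?_ hΛ
      split_ifs with h0
      · simp [h0]
      · have : (1 : ℝ) ≤ gapCount d L := by exact_mod_cast Nat.pos_of_ne_zero h0
        nlinarith
  refine (Finset.sum_le_sum h2).trans ?_
  rw [Finset.sum_add_distrib, ← Finset.sum_filter, ← Finset.sum_filter]
  refine add_le_add ?_ ?_
  · refine Finset.sum_le_sum_of_subset_of_nonneg ?_ fun d _ _ =>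
      mul_nonneg vonMangoldt_nonneg (by positivity)
    intro d hd
    simp only [Finset.mem_filter, Finset.mem_Icc] at hd ⊢
    omega
  · refine Finset.sum_le_sum_of_subset_of_nonneg ?_ fun d _ _ =>
      mul_nonneg vonMangoldt_nonneg (hsq d)
    intro d hd
    simp only [Finset.mem_filter, Finset.mem_Icc, Finset.mem_Ioc] at hd ⊢
    omega

lemma sum_Icc_one_div (Y : ℕ) : ∑ d ∈ Finset.Icc 1 Y, 1 / (d : ℝ) = harm Y := by
  induction Y with
  | zero => simp [harm]
  | succ Y ih => rw [Finset.sum_Icc_succ_top (by omega), ih, harm_succ]; push_cast; rfl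

open ArithmeticFunction in
lemma sum_vonMangoldt_div_le (Y : ℕ) :
    ∑ d ∈ Finset.Icc 1 Y, vonMangoldt d / d ≤ (1 + Real.log Y) ^ 2 := by
  have hlog : 0 ≤ Real.log Y := Real.log_natCast_nonneg Y
  calc ∑ d ∈ Finset.Icc 1 Y, vonMangoldt d / d
      ≤ ∑ d ∈ Finset.Icc 1 Y, Real.log Y * (1 / d) := by
        refine Finset.sum_le_sum fun d hd => ?_
        have hd := Finset.mem_Icc.1 hd
        rw [mul_one_div]
        refine div_le_div_of_nonneg_right (vonMangoldt_le_log.trans ?_) (by positivity)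
        exact Real.log_le_log (by exact_mod_cast hd.1) (by exact_mod_cast hd.2)
    _ = Real.log Y * harm Y := by
        rw [← Finset.mul_sum, sum_Icc_one_div]
    _ ≤ Real.log Y * (1 + Real.log Y) := by gcongr; exact harm_le Y
    _ ≤ _ := by nlinarith

open ArithmeticFunction in
lemma sum_vonMangoldt_le {Y : ℕ} :
    ∑ d ∈ Finset.Icc 1 Y, vonMangoldt d ≤ Y * (1 + Real.log Y) := by
  calc ∑ d ∈ Finset.Icc 1 Y, vonMangoldt d ≤ ∑ d ∈ Finset.Icc 1 Y, (1 + Real.log Y) := by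
        refine Finset.sum_le_sum fun d hd => ?_
        have hd := Finset.mem_Icc.1 hd
        have := Real.log_le_log (x := d) (y := Y) (by exact_mod_cast hd.1) (by exact_mod_cast hd.2)
        linarith [vonMangoldt_le_log (n := d)]
    _ = _ := by simp; ring

open ArithmeticFunction in
lemma sum_vonMangoldt_div_sq_le {Y : ℕ} (hY : 1 ≤ Y) (M : ℕ) :
    ∑ d ∈ Finset.Ioc Y M, vonMangoldt d / (d : ℝ) ^ 2 ≤ (2 + Real.log Y) / Y := by
  rcases le_total M Y with h | h
  · rw [Finset.Ioc_eq_empty_of_le h, Finset.sum_empty]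
    have := Real.log_natCast_nonneg Y
    positivity
  suffices ∑ d ∈ Finset.Ioc Y M, vonMangoldt d / (d : ℝ) ^ 2 ≤
      (2 + Real.log Y) / Y - (2 + Real.log M) / M by
    have h0 := Real.log_natCast_nonneg M
    have : 0 ≤ (2 + Real.log M) / M := by positivity
    linarith
  induction M, h using Nat.le_induction with
  | base => simp
  | succ M hM ih =>
    rw [← Finset.insert_Ioc_right_eq_Ioc_add_one (by omega), Finset.sum_insert (by simp)]
    have hM1 : (1 : ℝ) ≤ M := by exact_mod_cast hY.trans hM
    have key : vonMangoldt (M + 1) / ((M + 1 : ℕ) : ℝ) ^ 2 ≤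
        (2 + Real.log M) / M - (2 + Real.log (M + 1 : ℕ)) / (M + 1 : ℕ) := by
      have h1 : vonMangoldt (M + 1) ≤ Real.log (M + 1 : ℕ) := vonMangoldt_le_log
      have h2 : Real.log (M + 1 : ℕ) ≤ Real.log M + 1 / M := by
        have := Real.log_le_sub_one_of_pos (x := ((M + 1 : ℕ) : ℝ) / M) (by positivity)
        rw [Real.log_div (by positivity) (by positivity)] at this
        have h3 : ((M + 1 : ℕ) : ℝ) / M - 1 = 1 / M := by push_cast; field_simp; ring
        linarith
      have h0 := Real.log_natCast_nonneg M
      have h0' := Real.log_natCast_nonneg (M + 1)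
      set a := Real.log M
      set b := Real.log (M + 1 : ℕ)
      push_cast
      calc vonMangoldt (M + 1) / ((M : ℝ) + 1) ^ 2 ≤ b / ((M : ℝ) + 1) ^ 2 := by gcongr
        _ ≤ (2 + (b - 1 / M)) / M - (2 + b) / (M + 1) := by
          rw [← sub_nonneg]
          have : (2 + (b - 1 / (M : ℝ))) / M - (2 + b) / (M + 1) - b / ((M : ℝ) + 1) ^ 2 =
              (b * M + (M + 1) * (M - 1)) / (M ^ 2 * (M + 1) ^ 2) := by
            field_simp; ring
          rw [this]
          refine div_nonneg (add_nonneg (by positivity) (mul_nonneg (by positivity) (by linarith)))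
            (by positivity)
        _ ≤ (2 + a) / M - (2 + b) / (M + 1) := by gcongr; linarith
    linarith

open ArithmeticFunction in
lemma cycExp_smallPart_sq_le (Y m : ℕ) :
    cycExp m (fun L => (∑ d ∈ Finset.Icc 1 Y, vonMangoldt d * (gapCount d L : ℝ)) ^ 2) ≤
      (1 + Real.log Y) ^ 2 * (2 * harm m ^ 2 * (1 + Real.log Y) ^ 2 +
        harm m * (Y * (1 + Real.log Y))) := by
  set A := ∑ d ∈ Finset.Icc 1 Y, vonMangoldt d / d with hA
  have hA0 : 0 ≤ A := Finset.sum_nonneg fun d _ => div_nonneg vonMangoldt_nonneg (by positivity)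
  have hA1 := sum_vonMangoldt_div_le Y
  rw [← hA] at hA1
  have hH := harm_nonneg m
  calc cycExp m (fun L => (∑ d ∈ Finset.Icc 1 Y, vonMangoldt d * (gapCount d L : ℝ)) ^ 2)
      ≤ cycExp m (fun L => A * ∑ d ∈ Finset.Icc 1 Y, vonMangoldt d * d * (gapCount d L : ℝ) ^ 2) := by
        refine cycExp_mono fun L _ => ?_
        refine Finset.sum_sq_le_sum_mul_sum_of_sq_le_mul _
          (fun d _ => div_nonneg vonMangoldt_nonneg (by positivity))
          (fun d _ => mul_nonneg (mul_nonneg vonMangoldt_nonneg (by positivity)) (by positivity))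
          (fun d hd => ?_)
        have : (d : ℝ) ≠ 0 := by
          have := (Finset.mem_Icc.1 hd).1
          positivity
        refine le_of_eq ?_
        field_simp
    _ = A * ∑ d ∈ Finset.Icc 1 Y, vonMangoldt d * d * cycExp m (fun L => (gapCount d L : ℝ) ^ 2) := by
        rw [cycExp_const_mul, cycExp_sum]
        simp only [cycExp_const_mul]
    _ ≤ A * ∑ d ∈ Finset.Icc 1 Y, (2 * harm m ^ 2 * (vonMangoldt d / d) + harm m * vonMangoldt d) := by
        refine mul_le_mul_of_nonneg_left (Finset.sum_le_sum fun d hd => ?_) hA0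
        have hd := (Finset.mem_Icc.1 hd).1
        have hd' : (d : ℝ) ≠ 0 := by positivity
        refine (mul_le_mul_of_nonneg_left (cycExp_gapCount_sq_le hd m)
          (mul_nonneg vonMangoldt_nonneg (by positivity))).trans (le_of_eq ?_)
        field_simp
    _ = A * (2 * harm m ^ 2 * A + harm m * ∑ d ∈ Finset.Icc 1 Y, vonMangoldt d) := by
        rw [Finset.sum_add_distrib, ← Finset.mul_sum, ← Finset.mul_sum]
    _ ≤ _ := by
        have := sum_vonMangoldt_le (Y := Y)
        have h0 : 0 ≤ ∑ d ∈ Finset.Icc 1 Y, vonMangoldt d :=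
          Finset.sum_nonneg fun d _ => vonMangoldt_nonneg
        gcongr

open ArithmeticFunction in
lemma cycExp_largePart_le {Y : ℕ} (hY : 1 ≤ Y) (m : ℕ) :
    cycExp m (fun L => ∑ d ∈ Finset.Ioc Y m,
      vonMangoldt d * ((gapCount d L : ℝ) * ((gapCount d L : ℝ) - 1))) ≤
      2 * harm m ^ 2 * ((2 + Real.log Y) / Y) := by
  rw [cycExp_sum]
  simp only [cycExp_const_mul]
  refine le_trans (Finset.sum_le_sum (g := fun d => 2 * harm m ^ 2 * (vonMangoldt d / (d : ℝ) ^ 2))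
    fun d hd => ?_) ?_
  · have hd : 0 < d := by have := (Finset.mem_Ioc.1 hd).1; omega
    refine (mul_le_mul_of_nonneg_left (cycExp_gapCount_pairs_le hd m) vonMangoldt_nonneg).trans
      (le_of_eq ?_)
    ring
  · rw [← Finset.mul_sum]
    exact mul_le_mul_of_nonneg_left (sum_vonMangoldt_div_sq_le hY m) (by positivity)

/-- The probability that the logarithm of the least common multiple is much smaller than the sum of
the logarithms of the visited states. -/
lemma cycExp_stateLog_sub_large_le {Y : ℕ} (hY : 1 ≤ Y) (m : ℕ) {t : ℝ} (ht : 0 < t) :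
    cycExp m (fun L => if 2 * t < stateLog L - Real.log (gapLcm L) then 1 else 0) ≤
      harm m / t + (4 / t ^ 2) * ((1 + Real.log Y) ^ 2 * (2 * harm m ^ 2 * (1 + Real.log Y) ^ 2 +
        harm m * (Y * (1 + Real.log Y)))) +
      (2 / t) * (2 * harm m ^ 2 * ((2 + Real.log Y) / Y)) := by
  set D1 : List (ℕ × ℕ) → ℝ := fun L => ∑ d ∈ Finset.Icc 1 Y,
    ArithmeticFunction.vonMangoldt d * (gapCount d L : ℝ) with hD1
  set D2 : List (ℕ × ℕ) → ℝ := fun L => ∑ d ∈ Finset.Ioc Y m,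
    ArithmeticFunction.vonMangoldt d * ((gapCount d L : ℝ) * ((gapCount d L : ℝ) - 1)) with hD2
  have hD2nn : ∀ L, 0 ≤ D2 L := by
    intro L
    refine Finset.sum_nonneg fun d _ => mul_nonneg ArithmeticFunction.vonMangoldt_nonneg ?_
    rcases Nat.eq_zero_or_pos (gapCount d L) with h0 | h0
    · simp [h0]
    · have : (1 : ℝ) ≤ gapCount d L := by exact_mod_cast h0
      exact mul_nonneg (by linarith) (by linarith)
  have hle : cycExp m (fun L => if 2 * t < stateLog L - Real.log (gapLcm L) then 1 else 0) ≤
      cycExp m (fun L => (1 / t) * (stateLog L - gapLog L) + (4 / t ^ 2) * D1 L ^ 2 +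
        (2 / t) * D2 L) := by
    refine cycExp_mono fun L hL => ?_
    have h1 := gapLog_le_stateLog hL
    have h2 := gapLog_sub_log_gapLcm_le Y hL
    change _ ≤ D1 L + D2 L at h2
    have h3 := hD2nn L
    have n1 : 0 ≤ (1 / t) * (stateLog L - gapLog L) := mul_nonneg (by positivity) (by linarith)
    have n2 : 0 ≤ (4 / t ^ 2) * D1 L ^ 2 := by positivity
    have n3 : 0 ≤ (2 / t) * D2 L := by positivity
    split_ifs with h
    · by_cases c1 : t < stateLog L - gapLog L
      · have : 1 ≤ (1 / t) * (stateLog L - gapLog L) := by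
          rw [one_div, inv_mul_eq_div, one_le_div ht]; exact c1.le
        linarith
      · by_cases c2 : t < 2 * D2 L
        · have : 1 ≤ (2 / t) * D2 L := by
            rw [div_mul_eq_mul_div, one_le_div ht]; exact c2.le
          linarith
        · have c3 : t ≤ 2 * D1 L := by linarith
          have : 1 ≤ (4 / t ^ 2) * D1 L ^ 2 := by
            rw [div_mul_eq_mul_div, one_le_div (by positivity)]; nlinarith
          linarith
    · linarith
  refine hle.trans ?_
  rw [cycExp_add, cycExp_add, cycExp_const_mul, cycExp_const_mul, cycExp_const_mul]
  have e1 := cycExp_stateLog_sub_gapLog_le m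
  have e2 := cycExp_smallPart_sq_le Y m
  have e3 := cycExp_largePart_le hY m
  have : harm m / t = (1 / t) * harm m := by ring
  rw [this]
  gcongr

/-- The distribution functions of the logarithm of the least common multiple and of the sum of the
logarithms of the states are close. -/
theorem exists_cycExp_log_gapLcm_bounds : ∃ C : ℝ, 0 < C ∧ ∀ m : ℕ, 1 ≤ m → ∀ y : ℝ,
    cycExp m (fun L => if stateLog L ≤ y then 1 else 0) ≤
      cycExp m (fun L => if Real.log (gapLcm L) ≤ y then 1 else 0) ∧
    cycExp m (fun L => if Real.log (gapLcm L) ≤ y then 1 else 0) ≤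
      cycExp m (fun L => if stateLog L ≤ y + 2 * (1 + Real.log m) ^ ((5 : ℝ) / 4) then 1 else 0) +
        C / (1 + Real.log m) ^ ((1 : ℝ) / 4) := by
  refine ⟨10 ^ 8, by norm_num, fun m hm y => ⟨?_, ?_⟩⟩
  · refine cycExp_mono fun L hL => ?_
    have h1 := gapLog_le_stateLog hL
    have h2 := log_gapLcm_le_gapLog hL
    split_ifs <;> first | (exfalso; linarith) | norm_num
  set l := 1 + Real.log m with hl
  have hl1 : 1 ≤ l := by have := Real.log_natCast_nonneg m; linarith
  set v := l ^ ((1 : ℝ) / 24) with hv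
  have hv1 : 1 ≤ v := Real.one_le_rpow hl1 (by norm_num)
  have hv24 : v ^ 24 = l := by
    rw [hv, ← Real.rpow_natCast, ← Real.rpow_mul (by linarith)]; norm_num
  have ht : l ^ ((5 : ℝ) / 4) = v ^ 30 := by
    rw [hv, ← Real.rpow_natCast, ← Real.rpow_mul (by linarith)]; norm_num
  have hq : l ^ ((1 : ℝ) / 4) = v ^ 6 := by
    rw [hv, ← Real.rpow_natCast, ← Real.rpow_mul (by linarith)]; norm_num
  rw [ht, hq]
  have hv0 : 0 < v := by linarith
  set Y := ⌈v ^ 27⌉₊ with hYdef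
  have hY1 : v ^ 27 ≤ Y := Nat.le_ceil _
  have hv27 : 1 ≤ v ^ 27 := one_le_pow₀ hv1
  have hY2 : (Y : ℝ) ≤ 2 * v ^ 27 := by
    have := (Nat.ceil_lt_add_one (a := v ^ 27) (by positivity)).le
    linarith
  have hY : 1 ≤ Y := by
    have : (1 : ℝ) ≤ Y := hv27.trans hY1
    exact_mod_cast this
  have hlogY : 1 + Real.log Y ≤ 29 * v := by
    have h1 : Real.log Y ≤ Real.log (2 * v ^ 27) :=
      Real.log_le_log (by exact_mod_cast hY) hY2
    rw [Real.log_mul (by norm_num) (by positivity), Real.log_pow] at h1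
    have h2 := Real.log_two_lt_d9
    have h3 := Real.log_le_sub_one_of_pos hv0
    push_cast at h1
    linarith
  have hlogY0 : 0 ≤ Real.log Y := Real.log_natCast_nonneg Y
  have hH : harm m ≤ v ^ 24 := by rw [hv24]; exact harm_le m
  have hH0 := harm_nonneg m
  have hmain := cycExp_stateLog_sub_large_le hY m (t := v ^ 30) (by positivity)
  have hbound : cycExp m (fun L => if 2 * v ^ 30 < stateLog L - Real.log (gapLcm L) then 1 else 0) ≤
      10 ^ 8 / v ^ 6 := by
    refine hmain.trans ?_
    have b1 : harm m / v ^ 30 ≤ 1 / v ^ 6 := by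
      rw [div_le_div_iff₀ (by positivity) (by positivity)]
      calc harm m * v ^ 6 ≤ v ^ 24 * v ^ 6 := by gcongr
        _ = 1 * v ^ 30 := by ring
    have b2 : (4 / (v ^ 30) ^ 2) * ((1 + Real.log Y) ^ 2 * (2 * harm m ^ 2 * (1 + Real.log Y) ^ 2 +
        harm m * (Y * (1 + Real.log Y)))) ≤ (8 * 29 ^ 4 + 8 * 29 ^ 3) / v ^ 6 := by
      calc _ ≤ (4 / (v ^ 30) ^ 2) * ((29 * v) ^ 2 * (2 * (v ^ 24) ^ 2 * (29 * v) ^ 2 +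
        v ^ 24 * (2 * v ^ 27 * (29 * v)))) := by gcongr
        _ = (8 * 29 ^ 4 + 8 * 29 ^ 3 * v ^ 2) / v ^ 8 := by field_simp; ring
        _ ≤ (8 * 29 ^ 4 * v ^ 2 + 8 * 29 ^ 3 * v ^ 2) / v ^ 8 := by
          have : 1 ≤ v ^ 2 := one_le_pow₀ hv1
          refine div_le_div_of_nonneg_right ?_ (by positivity)
          linarith
        _ = _ := by field_simp
    have b3 : (2 / v ^ 30) * (2 * harm m ^ 2 * ((2 + Real.log Y) / Y)) ≤ (8 * 29) / v ^ 6 := by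
      calc _ ≤ (2 / v ^ 30) * (2 * (v ^ 24) ^ 2 * ((2 * (29 * v)) / v ^ 27)) := by
            gcongr; linarith
        _ = (8 * 29) / v ^ 8 := by field_simp; norm_num
        _ ≤ _ := by gcongr; norm_num
    calc _ ≤ 1 / v ^ 6 + (8 * 29 ^ 4 + 8 * 29 ^ 3) / v ^ 6 + (8 * 29) / v ^ 6 := by linarith
      _ = (1 + (8 * 29 ^ 4 + 8 * 29 ^ 3) + 8 * 29) / v ^ 6 := by ring
      _ ≤ _ := by gcongr; norm_num
  refine le_trans ?_ (add_le_add_right hbound _)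
  rw [← cycExp_add]
  refine cycExp_mono fun L _ => ?_
  split_ifs <;> first | (exfalso; linarith) | norm_num

/-! ### Asymptotic normality of the sum of the logarithms of the states -/

lemma log_succ_sub_log_bounds {i : ℕ} (hi : 1 ≤ i) :
    1 / ((i : ℝ) + 1) ≤ Real.log (i + 1 : ℕ) - Real.log i ∧
      Real.log (i + 1 : ℕ) - Real.log i ≤ 1 / i := by
  have hi' : (1 : ℝ) ≤ i := by exact_mod_cast hi
  have h1 := Real.log_le_sub_one_of_pos (x := (i : ℝ) / (i + 1 : ℕ)) (by positivity)
  have h2 := Real.log_le_sub_one_of_pos (x := ((i + 1 : ℕ) : ℝ) / i) (by positivity)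
  rw [Real.log_div (by positivity) (by positivity)] at h1 h2
  have e1 : (i : ℝ) / (i + 1 : ℕ) - 1 = -(1 / ((i : ℝ) + 1)) := by push_cast; field_simp; ring
  have e2 : ((i + 1 : ℕ) : ℝ) / i - 1 = 1 / i := by push_cast; field_simp; ring
  constructor <;> linarith

lemma one_div_le_two_div_succ {i : ℕ} (hi : 1 ≤ i) : 1 / (i : ℝ) ≤ 2 / ((i : ℝ) + 1) := by
  have hi' : (1 : ℝ) ≤ i := by exact_mod_cast hi
  rw [div_le_div_iff₀ (by positivity) (by positivity)]
  linarith

lemma abs_mean_sub_le (m : ℕ) (hm : 1 ≤ m) :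
    |∑ i ∈ Finset.range m, 1 / ((i : ℝ) + 1) * Real.log i - Real.log m ^ 2 / 2| ≤
      3 * (1 + Real.log m) := by
  suffices h : ∑ i ∈ Finset.range m, 1 / ((i : ℝ) + 1) * Real.log i ≤ Real.log m ^ 2 / 2 ∧
      Real.log m ^ 2 / 2 ≤ ∑ i ∈ Finset.range m, 1 / ((i : ℝ) + 1) * Real.log i + 3 * harm m by
    have := harm_le m
    rw [abs_le]; constructor <;> linarith [Real.log_natCast_nonneg m]
  induction m, hm using Nat.le_induction with
  | base => simp [harm]
  | succ i hi ih =>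
    rw [Finset.sum_range_succ, harm_succ]
    obtain ⟨hd1, hd2⟩ := log_succ_sub_log_bounds hi
    have hd3 := hd2.trans (one_div_le_two_div_succ hi)
    have hi' : (1 : ℝ) ≤ i := by exact_mod_cast hi
    have ha := Real.log_natCast_nonneg i
    have hai : Real.log i ≤ i := (Real.log_le_sub_one_of_pos (by positivity)).trans (by linarith)
    have hi1 : 1 / (i : ℝ) ≤ 1 := by rw [div_le_one (by positivity)]; exact hi'
    obtain ⟨d, hd⟩ : ∃ d, Real.log (i + 1 : ℕ) = Real.log i + d :=
        ⟨_, (add_sub_cancel _ _).symm⟩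
    rw [hd] at hd1 hd2 hd3 ⊢
    set a := Real.log i
    rw [add_sub_cancel_left] at hd1 hd2 hd3
    have hd0 : 0 ≤ d := le_trans (by positivity) hd1
    have hA : a * (1 / i) ≤ a * (1 / ((i : ℝ) + 1)) + 1 / ((i : ℝ) + 1) := by
      have : a * (1 / ((i : ℝ) + 1)) + 1 / ((i : ℝ) + 1) - a * (1 / i) =
        (i - a) / (i * ((i : ℝ) + 1)) := by field_simp; ring
      have h2 : 0 ≤ (i - a) / (i * ((i : ℝ) + 1)) := div_nonneg (by linarith) (by positivity)
      linarith
    have hB : d ^ 2 ≤ 2 * (1 / ((i : ℝ) + 1)) := by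
      calc d ^ 2 = d * d := sq d
        _ ≤ 1 * (2 / ((i : ℝ) + 1)) := mul_le_mul (by linarith) hd3 hd0 (by norm_num)
        _ = _ := by ring
    have h1 := mul_le_mul_of_nonneg_left hd1 ha
    have h2 := mul_le_mul_of_nonneg_left hd2 ha
    constructor <;> nlinarith

lemma abs_variance_sub_le (m : ℕ) (hm : 1 ≤ m) :
    |∑ i ∈ Finset.range m, 1 / ((i : ℝ) + 1) * (1 - 1 / ((i : ℝ) + 1)) * Real.log i ^ 2 -
      Real.log m ^ 3 / 3| ≤ 5 * (1 + Real.log m) ^ 2 := by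
  have h : ∀ l : ℝ, Real.log m ≤ l →
      ∑ i ∈ Finset.range m, 1 / ((i : ℝ) + 1) * (1 - 1 / ((i : ℝ) + 1)) * Real.log i ^ 2 ≤
        Real.log m ^ 3 / 3 ∧
      Real.log m ^ 3 / 3 ≤ ∑ i ∈ Finset.range m,
        1 / ((i : ℝ) + 1) * (1 - 1 / ((i : ℝ) + 1)) * Real.log i ^ 2 + (4 * l + 1) * harm m := by
    intro l hl
    induction m, hm using Nat.le_induction with
    | base =>
      have : 0 ≤ l := by simpa using hl
      simp [harm]; linarith
    | succ i hi ih =>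
      rw [Finset.sum_range_succ, harm_succ]
      obtain ⟨hd1, hd2⟩ := log_succ_sub_log_bounds hi
      have hd3 := hd2.trans (one_div_le_two_div_succ hi)
      have hi' : (1 : ℝ) ≤ i := by exact_mod_cast hi
      have ha := Real.log_natCast_nonneg i
      have hai : Real.log i ≤ i := (Real.log_le_sub_one_of_pos (by positivity)).trans (by linarith)
      have hi1 : 1 / (i : ℝ) ≤ 1 := by rw [div_le_one (by positivity)]; exact hi'
      have hal : Real.log i ≤ l := by
        have : 0 < 1 / ((i : ℝ) + 1) := by positivity
        linarith
      obtain ⟨ih1, ih2⟩ := ih hal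
      obtain ⟨d, hd⟩ : ∃ d, Real.log (i + 1 : ℕ) = Real.log i + d :=
        ⟨_, (add_sub_cancel _ _).symm⟩
      rw [hd] at hd1 hd2 hd3 ⊢
      set a := Real.log i
      rw [add_sub_cancel_left] at hd1 hd2 hd3
      have hd0 : 0 ≤ d := le_trans (by positivity) hd1
      set q := 1 / ((i : ℝ) + 1) with hq
      have hq0 : 0 < q := by positivity
      have hq2 : 2 / ((i : ℝ) + 1) = 2 * q := by ring
      rw [hq2] at hd3
      have e : (a + d) ^ 3 / 3 = a ^ 3 / 3 + a ^ 2 * d + a * d ^ 2 + d ^ 3 / 3 := by ring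
      have hA : a ^ 2 * (1 / i) ≤ q * (1 - q) * a ^ 2 + 2 * a * q := by
        have h1 : q * (1 - q) * a ^ 2 + 2 * a * q - a ^ 2 * (1 / i) =
            a * (2 * i * (i + 1) - a * (2 * i + 1)) / (i * ((i : ℝ) + 1) ^ 2) := by
          rw [hq]; field_simp; ring
        have h2 : 0 ≤ a * (2 * i * (i + 1) - a * (2 * i + 1)) / (i * ((i : ℝ) + 1) ^ 2) :=
          div_nonneg (mul_nonneg ha (by nlinarith)) (by positivity)
        linarith
      have hB : d ^ 2 ≤ 2 * q := by
        calc d ^ 2 = d * d := sq d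
          _ ≤ 1 * (2 * q) := mul_le_mul (by linarith) hd3 hd0 (by norm_num)
          _ = _ := by ring
      have hC : d ^ 3 ≤ 2 * q := by
        calc d ^ 3 = d * d ^ 2 := by ring
          _ ≤ 1 * (2 * q) := mul_le_mul (by linarith) hB (by positivity) (by norm_num)
          _ = _ := by ring
      have hD := mul_le_mul_of_nonneg_left hB ha
      have h1 := mul_le_mul_of_nonneg_left hd1 (sq_nonneg a)
      have h2 := mul_le_mul_of_nonneg_left hd2 (sq_nonneg a)
      have h3 := mul_le_mul_of_nonneg_right hal hq0.le
      have h4 : 0 ≤ q * q * a ^ 2 := by positivity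
      have h5 : 0 ≤ a * d ^ 2 := by positivity
      have h6 : 0 ≤ d ^ 3 := by positivity
      constructor <;> nlinarith
  obtain ⟨h1, h2⟩ := h _ le_rfl
  have h3 := harm_le m
  have h0 := Real.log_natCast_nonneg m
  have h4 : (4 * Real.log m + 1) * harm m ≤ (4 * Real.log m + 1) * (1 + Real.log m) := by gcongr
  rw [abs_le]; constructor <;> nlinarith

lemma abs_cycExp_stateLog_sub_le {w : ℝ} (hw : 10 ≤ w) {m : ℕ} (hm : |Real.log m - w ^ 4| ≤ w)
    {s : ℝ} (hs0 : 0 ≤ s) (hs : s ≤ 8 * w ^ 5) (x : ℝ) :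
    |cycExp m (fun L => if stateLog L ≤ w ^ 8 / 2 + (Real.sqrt 3)⁻¹ * w ^ 6 * x + s then 1 else 0) -
      stdNormalCDF x| ≤ 500 * (|x| + w ^ 2) / w ^ 3 := by
  obtain ⟨hl1, hl2⟩ := abs_le.1 hm
  have hw0 : 0 < w := by linarith
  have hw3 : 1000 * w ≤ w ^ 4 := by
    have : (10 : ℝ) ^ 3 ≤ w ^ 3 := by gcongr
    nlinarith
  have hmpos : 1 ≤ m := by
    rcases Nat.eq_zero_or_pos m with rfl | h
    · simp at hl1; nlinarith
    · exact h
  have hmean := abs_mean_sub_le m hmpos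
  have hvar := abs_variance_sub_le m hmpos
  set l := Real.log m with hl
  set M := ∑ i ∈ Finset.range m, 1 / ((i : ℝ) + 1) * Real.log i with hM
  set V := ∑ i ∈ Finset.range m, 1 / ((i : ℝ) + 1) * (1 - 1 / ((i : ℝ) + 1)) * Real.log i ^ 2
    with hV
  have hl0 : 0 ≤ l := by nlinarith
  have hl3 : l ≤ 2 * w ^ 4 := by nlinarith
  have h1l : 1 + l ≤ 3 * w ^ 4 := by nlinarith
  have hcube : |l ^ 3 / 3 - w ^ 12 / 3| ≤ 7 * w ^ 9 := by
    have e : l ^ 3 / 3 - w ^ 12 / 3 = (l - w ^ 4) * ((l ^ 2 + l * w ^ 4 + w ^ 8) / 3) := by ring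
    have hp : 0 ≤ (l ^ 2 + l * w ^ 4 + w ^ 8) / 3 := by positivity
    rw [e, abs_mul, abs_of_nonneg hp]
    calc |l - w ^ 4| * ((l ^ 2 + l * w ^ 4 + w ^ 8) / 3)
        ≤ w * (((2 * w ^ 4) ^ 2 + (2 * w ^ 4) * w ^ 4 + w ^ 8) / 3) := by gcongr
      _ = 7 / 3 * w ^ 9 := by ring
      _ ≤ 7 * w ^ 9 := by gcongr; norm_num
  have hV1 : |V - w ^ 12 / 3| ≤ 52 * w ^ 9 := by
    have h1 : 5 * (1 + l) ^ 2 ≤ 5 * (3 * w ^ 4) ^ 2 := by gcongr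
    have h2 : w ^ 8 ≤ w ^ 9 := pow_le_pow_right₀ (by linarith) (by norm_num)
    have h3 : |V - w ^ 12 / 3| ≤ |V - l ^ 3 / 3| + |l ^ 3 / 3 - w ^ 12 / 3| := abs_sub_le _ _ _
    have h4 : 5 * (3 * w ^ 4) ^ 2 = 45 * w ^ 8 := by ring
    linarith
  have hw9 : 1000 * w ^ 9 ≤ w ^ 12 := by
    calc 1000 * w ^ 9 = (1000 * w) * w ^ 8 := by ring
      _ ≤ w ^ 4 * w ^ 8 := by gcongr
      _ = _ := by ring
  have hVlow : (w ^ 6 / 4) ^ 2 ≤ V := by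
    have := (abs_le.1 hV1).1
    have e : (w ^ 6 / 4) ^ 2 = w ^ 12 / 16 := by ring
    rw [e]
    have : 0 ≤ w ^ 12 := by positivity
    linarith
  set σ := Real.sqrt V with hσ
  have hσlow : w ^ 6 / 4 ≤ σ := Real.le_sqrt_of_sq_le hVlow
  have hσ0 : 0 < σ := lt_of_lt_of_le (by positivity) hσlow
  have hσ2 : σ ^ 2 = V := Real.sq_sqrt ((sq_nonneg _).trans hVlow)
  have hc : (Real.sqrt 3)⁻¹ ^ 2 = 1 / 3 := by rw [inv_pow, Real.sq_sqrt (by norm_num)]; norm_num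
  have hc0 : 0 < (Real.sqrt 3)⁻¹ := by positivity
  set c := (Real.sqrt 3)⁻¹ with hcdef
  have hc2 : 1 / 2 ≤ c := by nlinarith
  have hσdiff : |c * w ^ 6 - σ| ≤ 104 * w ^ 3 := by
    have e : (c * w ^ 6 - σ) * (c * w ^ 6 + σ) = -(V - w ^ 12 / 3) := by
      have : (c * w ^ 6 - σ) * (c * w ^ 6 + σ) = c ^ 2 * w ^ 12 - σ ^ 2 := by ring
      rw [this, hc, hσ2]; ring
    have hp : w ^ 6 / 2 ≤ c * w ^ 6 + σ := by
      have : 1 / 2 * w ^ 6 ≤ c * w ^ 6 := by gcongr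
      linarith
    have h1 : |c * w ^ 6 - σ| * (w ^ 6 / 2) ≤ 52 * w ^ 9 := by
      calc _ ≤ |c * w ^ 6 - σ| * (c * w ^ 6 + σ) := by gcongr
        _ = |(c * w ^ 6 - σ) * (c * w ^ 6 + σ)| := by
          rw [abs_mul, abs_of_pos (a := c * w ^ 6 + σ) (by positivity)]
        _ ≤ _ := by rw [e, abs_neg]; exact hV1
    have h2 : 52 * w ^ 9 = (104 * w ^ 3) * (w ^ 6 / 2) := by ring
    rw [h2] at h1
    exact le_of_mul_le_mul_right h1 (by positivity)
  obtain ⟨m', rfl⟩ : ∃ m', m = m' + 1 := ⟨m - 1, by omega⟩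
  set y := w ^ 8 / 2 + c * w ^ 6 * x + s with hy
  have hBE := bernExp_berryEsseen (p := fun i => 1 / ((i : ℝ) + 1)) (s := Finset.range (m' + 1))
    (a := fun i => Real.log i) (D := l) hσ0
    (fun i _ => ⟨by positivity, by rw [div_le_one (by positivity)]; linarith [i.cast_nonneg (α := ℝ)]⟩)
    hl0 (fun i hi => ⟨Real.log_natCast_nonneg i, by
      rcases Nat.eq_zero_or_pos i with rfl | h
      · simpa using hl0
      · exact Real.log_le_log (by exact_mod_cast h)
          (by exact_mod_cast (Finset.mem_range.1 hi).le)⟩) (by rw [hσ2]) (y - l)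
  have hF : cycExp (m' + 1) (fun L => if stateLog L ≤ y then 1 else 0) =
      bernExp (fun i => 1 / ((i : ℝ) + 1)) (Finset.range (m' + 1))
        (fun V => if ∑ i ∈ V, Real.log i ≤ y - l then 1 else 0) := by
    rw [cycExp_stateLog (fun z => if z ≤ y then 1 else 0)]
    simp only [le_sub_iff_add_le']
    rw [hl]; push_cast; rfl
  rw [← hF] at hBE
  have hz : |(y - l - M) / σ - x| ≤ 4 * (31 * w ^ 5 + 104 * w ^ 3 * |x|) / w ^ 6 := by
    have e : (y - l - M) / σ - x = (-((l ^ 2 - w ^ 8) / 2) - (M - l ^ 2 / 2) - l + s +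
        (c * w ^ 6 - σ) * x) / σ := by
      rw [hy]; field_simp; ring
    have h1 : |(l ^ 2 - w ^ 8) / 2| ≤ 2 * w ^ 5 := by
      have e : (l ^ 2 - w ^ 8) / 2 = (l - w ^ 4) * ((l + w ^ 4) / 2) := by ring
      rw [e, abs_mul, abs_of_nonneg (a := (l + w ^ 4) / 2) (by positivity)]
      calc |l - w ^ 4| * ((l + w ^ 4) / 2) ≤ w * ((2 * w ^ 4 + w ^ 4) / 2) := by gcongr
        _ = 3 / 2 * w ^ 5 := by ring
        _ ≤ _ := by gcongr; norm_num
    have h2 : |M - l ^ 2 / 2| ≤ 9 * w ^ 5 := by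
      have : w ^ 4 ≤ w ^ 5 := pow_le_pow_right₀ (by linarith) (by norm_num)
      linarith
    have h3 : |l| ≤ 2 * w ^ 5 := by
      have : w ^ 4 ≤ w ^ 5 := pow_le_pow_right₀ (by linarith) (by norm_num)
      rw [abs_of_nonneg hl0]; linarith
    have h4 : |s| ≤ 8 * w ^ 5 := by rwa [abs_of_nonneg hs0]
    have h5 : |(c * w ^ 6 - σ) * x| ≤ 104 * w ^ 3 * |x| := by
      rw [abs_mul]; gcongr
    rw [e, abs_div, abs_of_pos hσ0, div_le_div_iff₀ hσ0 (by positivity)]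
    have h6 : |-((l ^ 2 - w ^ 8) / 2) - (M - l ^ 2 / 2) - l + s + (c * w ^ 6 - σ) * x| ≤
        31 * w ^ 5 + 104 * w ^ 3 * |x| := by
      have h7 : 0 ≤ w ^ 5 := by positivity
      rw [abs_le] at *
      constructor <;> linarith
    calc _ ≤ (31 * w ^ 5 + 104 * w ^ 3 * |x|) * w ^ 6 := by gcongr
      _ = 4 * (31 * w ^ 5 + 104 * w ^ 3 * |x|) * (w ^ 6 / 4) := by ring
      _ ≤ _ := by gcongr
  have hLip := (abs_stdNormalCDF_sub_le x ((y - l - M) / σ)).trans hz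
  have hDσ : 6 * (l / σ) ≤ 48 / w := by
    have : l / σ ≤ 2 * w ^ 4 / (w ^ 6 / 4) := by gcongr
    have e : 2 * w ^ 4 / (w ^ 6 / 4) = 8 / w ^ 2 := by field_simp; norm_num
    have : 8 / w ^ 2 ≤ 8 / w := by
      gcongr; nlinarith
    have : (48 : ℝ) / w = 6 * (8 / w) := by ring
    linarith
  have htot := (abs_sub_le _ _ _).trans (add_le_add (hBE.trans hDσ) hLip)
  refine htot.trans ?_
  have e : 48 / w + 4 * (31 * w ^ 5 + 104 * w ^ 3 * |x|) / w ^ 6 =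
      (172 * w ^ 2 + 416 * |x|) / w ^ 3 := by field_simp; ring
  rw [e]
  gcongr
  have := abs_nonneg x
  have := sq_nonneg w
  linarith

/-- Asymptotic normality of the logarithm of the order of a random permutation. -/
theorem exists_abs_cycExp_log_gapLcm_sub_le : ∃ C : ℝ, 0 < C ∧ ∀ w : ℝ, 10 ≤ w → ∀ m : ℕ,
    |Real.log m - w ^ 4| ≤ w → ∀ x : ℝ,
    |cycExp m (fun L => if Real.log (gapLcm L) ≤ w ^ 8 / 2 + (Real.sqrt 3)⁻¹ * w ^ 6 * x
      then 1 else 0) - stdNormalCDF x| ≤ C * (|x| + w ^ 2) / w ^ 3 := by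
  obtain ⟨C, hC, h⟩ := exists_cycExp_log_gapLcm_bounds
  refine ⟨600 + 2 * C, by positivity, fun w hw m hm x => ?_⟩
  obtain ⟨hl1, hl2⟩ := abs_le.1 hm
  have hw0 : 0 < w := by linarith
  have hw3 : 1000 * w ≤ w ^ 4 := by
    have : (10 : ℝ) ^ 3 ≤ w ^ 3 := by gcongr
    nlinarith
  have hmpos : 1 ≤ m := by
    rcases Nat.eq_zero_or_pos m with rfl | h
    · simp at hl1; nlinarith
    · exact h
  obtain ⟨h1, h2⟩ := h m hmpos (w ^ 8 / 2 + (Real.sqrt 3)⁻¹ * w ^ 6 * x)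
  have hs : 2 * (1 + Real.log m) ^ ((5 : ℝ) / 4) ≤ 8 * w ^ 5 := by
    have : (1 + Real.log m) ^ ((5 : ℝ) / 4) ≤ (5 / 4 * w) ^ 5 := by
      calc _ ≤ ((5 / 4 * w) ^ 4) ^ ((5 : ℝ) / 4) := by
            have := Real.log_natCast_nonneg m
            gcongr
            have : (5 / 4 * w) ^ 4 = 625 / 256 * w ^ 4 := by ring
            rw [this]; nlinarith
        _ = (5 / 4 * w) ^ 5 := by
            rw [← Real.rpow_natCast, ← Real.rpow_mul (by positivity), ← Real.rpow_natCast]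
            norm_num
    have e : (5 / 4 * w) ^ 5 = 3125 / 1024 * w ^ 5 := by ring
    have : 0 ≤ w ^ 5 := by positivity
    linarith
  have hq : C / (1 + Real.log m) ^ ((1 : ℝ) / 4) ≤ 2 * C / w := by
    have : w / 2 ≤ (1 + Real.log m) ^ ((1 : ℝ) / 4) := by
      calc w / 2 = ((w / 2) ^ 4) ^ ((1 : ℝ) / 4) := by
            rw [← Real.rpow_natCast, ← Real.rpow_mul (by positivity)]; norm_num
        _ ≤ _ := by
            gcongr
            have : (w / 2) ^ 4 = w ^ 4 / 16 := by ring
            rw [this]; nlinarith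
    calc _ ≤ C / (w / 2) := by gcongr
      _ = _ := by field_simp
  have b1 := abs_le.1 (abs_cycExp_stateLog_sub_le hw hm (s := 0) le_rfl (by positivity) x)
  have b2 := abs_le.1 (abs_cycExp_stateLog_sub_le hw hm (by
    have := Real.log_natCast_nonneg m
    positivity) hs x)
  rw [add_zero] at b1
  have e : (600 + 2 * C) * (|x| + w ^ 2) / w ^ 3 = 500 * (|x| + w ^ 2) / w ^ 3 +
      (100 + 2 * C) * |x| / w ^ 3 + 100 / w + 2 * C / w := by field_simp; ring
  have n1 : 0 ≤ (100 + 2 * C) * |x| / w ^ 3 := by positivity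
  have n2 : 0 ≤ 100 / w := by positivity
  have n3 : 0 ≤ 2 * C / w := by positivity
  rw [e, abs_le]
  constructor <;> linarith [b1.1, b2.2]

/-! ### The order of a uniform random permutation -/

/-- The proportion of permutations of a given cycle type (fixed points included). -/
def partWeight (s : Multiset ℕ) : ℝ :=
  ((s.prod * ∏ i ∈ s.toFinset, (s.count i).factorial : ℕ) : ℝ)⁻¹

lemma prod_count_factorial_eq {s : Multiset ℕ} {T : Finset ℕ} (h : s.toFinset ⊆ T) :
    ∏ i ∈ s.toFinset, (s.count i).factorial = ∏ i ∈ T, (s.count i).factorial := by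
  refine Finset.prod_subset h fun i _ hi => ?_
  rw [Multiset.count_eq_zero_of_notMem (by simpa using hi), Nat.factorial_zero]

lemma mul_partWeight_cons {a : ℕ} (ha : 0 < a) (s : Multiset ℕ) :
    ((a * (a ::ₘ s).count a : ℕ) : ℝ) * partWeight (a ::ₘ s) = partWeight s := by
  have h : (a ::ₘ s).prod * ∏ i ∈ (a ::ₘ s).toFinset, ((a ::ₘ s).count i).factorial =
      (a * (a ::ₘ s).count a) * (s.prod * ∏ i ∈ s.toFinset, (s.count i).factorial) := by
    rw [prod_count_factorial_eq (s := s) (T := insert a s.toFinset) (Finset.subset_insert _ _),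
      Multiset.toFinset_cons, Multiset.prod_cons,
      ← Finset.mul_prod_erase _ _ (Finset.mem_insert_self a s.toFinset),
      ← Finset.mul_prod_erase _ _ (Finset.mem_insert_self a s.toFinset),
      Multiset.count_cons_self, Nat.factorial_succ]
    have : ∏ i ∈ (insert a s.toFinset).erase a, ((a ::ₘ s).count i).factorial =
        ∏ i ∈ (insert a s.toFinset).erase a, (s.count i).factorial := by
      refine Finset.prod_congr rfl fun i hi => ?_
      rw [Multiset.count_cons_of_ne (Finset.ne_of_mem_erase hi)]
    rw [this]; ring
  have h0 : ((a * (a ::ₘ s).count a : ℕ) : ℝ) ≠ 0 := by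
    rw [Multiset.count_cons_self]; positivity
  unfold partWeight
  rw [h, Nat.cast_mul (a * _), mul_inv, mul_inv_cancel_left₀ h0]

/-- Expectation of a functional of the cycle type of a random permutation of `m` points. -/
def partExp (m : ℕ) (F : Multiset ℕ → ℝ) : ℝ :=
  ∑ p : m.Partition, partWeight p.parts * F p.parts

lemma sum_eq_sum_mul_count {m : ℕ} (p : m.Partition) :
    m = ∑ a ∈ Finset.Icc 1 m, a * p.parts.count a := by
  conv_lhs => rw [← p.parts_sum, Finset.sum_multiset_count]
  simp only [smul_eq_mul]
  rw [Finset.sum_subset (s₂ := Finset.Icc 1 m)]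
  · exact Finset.sum_congr rfl fun a _ => mul_comm _ _
  · intro a ha
    have ha := Multiset.mem_toFinset.1 ha
    exact Finset.mem_Icc.2 ⟨p.parts_pos ha, Nat.Partition.le_of_mem_parts ha⟩
  · intro a _ ha
    rw [Multiset.count_eq_zero_of_notMem (by simpa using ha), zero_mul]

lemma partExp_withPart {m a : ℕ} (ha1 : 1 ≤ a) (ha : a ≤ m) (F : Multiset ℕ → ℝ) :
    ∑ p : m.Partition, ((a * p.parts.count a : ℕ) : ℝ) * (partWeight p.parts * F p.parts) =
      partExp (m - a) (fun s => F (a ::ₘ s)) := by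
  have h1 : ∑ p : m.Partition, ((a * p.parts.count a : ℕ) : ℝ) * (partWeight p.parts * F p.parts) =
      ∑ p : {p : m.Partition // a ∈ p.parts},
        ((a * p.1.parts.count a : ℕ) : ℝ) * (partWeight p.1.parts * F p.1.parts) := by
    rw [← Finset.sum_subtype (Finset.univ.filter fun p : m.Partition => a ∈ p.parts) (by simp)
      (fun p => ((a * p.parts.count a : ℕ) : ℝ) * (partWeight p.parts * F p.parts))]
    refine (Finset.sum_filter_of_ne fun p _ hp => ?_).symm
    by_contra h
    rw [Multiset.count_eq_zero_of_notMem h] at hp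
    simp at hp
  rw [h1, partExp]
  refine (Fintype.sum_equiv (Nat.Partition.partitionWithPartEquiv ha1 ha).symm _ _ fun q => ?_).symm
  rw [Nat.Partition.partitionWithPartEquiv_symm_apply_parts, ← mul_assoc, mul_partWeight_cons ha1]

lemma partExp_succ (m : ℕ) (F : Multiset ℕ → ℝ) :
    partExp (m + 1) F =
      (∑ j ∈ Finset.range (m + 1), partExp j (fun s => F ((m + 1 - j) ::ₘ s))) / (m + 1) := by
  rw [eq_div_iff (by positivity)]
  have h1 : partExp (m + 1) F * (m + 1) = ∑ a ∈ Finset.Icc 1 (m + 1),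
      partExp (m + 1 - a) (fun s => F (a ::ₘ s)) := by
    rw [partExp, Finset.sum_mul, ← Finset.sum_congr rfl fun a ha =>
      partExp_withPart (Finset.mem_Icc.1 ha).1 (Finset.mem_Icc.1 ha).2 F, Finset.sum_comm]
    refine Finset.sum_congr rfl fun p _ => ?_
    rw [← Finset.sum_mul, ← Nat.cast_sum, ← sum_eq_sum_mul_count p]
    push_cast; ring
  rw [h1]
  refine Finset.sum_bij' (fun a _ => m + 1 - a) (fun j _ => m + 1 - j) ?_ ?_ ?_ ?_ ?_ <;>
    intro a ha <;> simp only [Finset.mem_Icc, Finset.mem_range] at ha ⊢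
  · omega
  · omega
  · omega
  · omega
  · rw [Nat.sub_sub_self ha.2]

lemma partExp_eq_cycExp (m : ℕ) (F : Multiset ℕ → ℝ) :
    partExp m F = cycExp m (fun L => F ((L.map Prod.snd : List ℕ) : Multiset ℕ)) := by
  induction m using Nat.strong_induction_on generalizing F with
  | _ m ih =>
    cases m with
    | zero =>
      rw [cycExp_zero, partExp, Fintype.sum_unique]
      simp [partWeight]
    | succ m =>
      rw [partExp_succ, cycExp_succ]
      congr 1
      refine Finset.sum_congr rfl fun j hj => ?_
      rw [ih j (Finset.mem_range.1 hj)]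
      rfl

section Perm

variable {α : Type*} [Fintype α] [DecidableEq α]

lemma card_partition_eq (p : (Fintype.card α).Partition) :
    ((Finset.univ.filter fun σ : Equiv.Perm α => σ.partition = p).card : ℝ) =
      (Fintype.card α).factorial * partWeight p.parts := by
  set c := p.parts.filter (2 ≤ ·) with hc
  obtain ⟨k, hk⟩ : ∃ k, p.parts = c + Multiset.replicate k 1 := by
    refine ⟨(p.parts.filter fun a => ¬ 2 ≤ a).card,
      (Multiset.filter_add_not (2 ≤ ·) p.parts).symm.trans ?_⟩
    congr 1
    refine Multiset.eq_replicate.2 ⟨rfl, fun b hb => ?_⟩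
    obtain ⟨hb1, hb2⟩ := Multiset.mem_filter.1 hb
    have := p.parts_pos hb1
    omega
  have hsum : c.sum + k = Fintype.card α := by
    rw [← p.parts_sum, hk]; simp
  have hc2 : ∀ a ∈ c, 2 ≤ a := fun a ha => (Multiset.mem_filter.1 ha).2
  have h1c : 1 ∉ c := fun h => by have := hc2 1 h; omega
  have hcard := Equiv.Perm.card_of_cycleType_mul_eq α c
  rw [if_pos ⟨by omega, hc2⟩] at hcard
  have hset : (Finset.univ.filter fun σ : Equiv.Perm α => σ.cycleType = c) =
      Finset.univ.filter fun σ : Equiv.Perm α => σ.partition = p := by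
    ext σ
    simp only [Finset.mem_filter, Finset.mem_univ, true_and]
    constructor
    · intro h
      refine Nat.Partition.ext ?_
      rw [Equiv.Perm.parts_partition, ← Equiv.Perm.sum_cycleType, h, hk]
      congr 2; omega
    · intro h
      rw [← Equiv.Perm.filter_parts_partition_eq_cycleType, h]
  rw [hset] at hcard
  have hz : p.parts.prod * ∏ i ∈ p.parts.toFinset, (p.parts.count i).factorial =
      (Fintype.card α - c.sum).factorial * c.prod * ∏ i ∈ c.toFinset, (c.count i).factorial := by
    have hT : p.parts.toFinset ⊆ insert 1 c.toFinset := by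
      intro a ha
      rw [Multiset.mem_toFinset, hk, Multiset.mem_add] at ha
      rw [Finset.mem_insert, Multiset.mem_toFinset]
      rcases ha with h | h
      · exact Or.inr h
      · exact Or.inl (Multiset.eq_of_mem_replicate h)
    rw [prod_count_factorial_eq hT, Finset.prod_insert (by simpa using h1c)]
    have h1 : p.parts.count 1 = k := by
      rw [hk, Multiset.count_add, Multiset.count_eq_zero_of_notMem h1c]; simp
    have h2 : ∏ i ∈ c.toFinset, (p.parts.count i).factorial =
        ∏ i ∈ c.toFinset, (c.count i).factorial := by
      refine Finset.prod_congr rfl fun i hi => ?_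
      have : i ≠ 1 := fun h => h1c (by rw [← h]; simpa using hi)
      rw [hk, Multiset.count_add, Multiset.count_replicate, if_neg (Ne.symm this), add_zero]
    have h3 : p.parts.prod = c.prod := by rw [hk]; simp
    have h4 : Fintype.card α - c.sum = k := by omega
    rw [h1, h2, h3, h4]; ring
  rw [partWeight, hz]
  have hne : (((Fintype.card α - c.sum).factorial * c.prod *
      ∏ i ∈ c.toFinset, (c.count i).factorial : ℕ) : ℝ) ≠ 0 := by
    intro h
    rw [Nat.cast_eq_zero.1 h, mul_zero] at hcard
    exact (Nat.factorial_pos _).ne hcard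
  rw [eq_mul_inv_iff_mul_eq₀ hne]
  exact_mod_cast hcard

lemma orderOf_eq_lcm_parts (σ : Equiv.Perm α) : orderOf σ = σ.partition.parts.lcm := by
  rw [Equiv.Perm.parts_partition, Multiset.lcm_add, Equiv.Perm.lcm_cycleType]
  have : (Multiset.replicate (Fintype.card α - σ.support.card) 1).lcm ∣ orderOf σ := by
    refine Multiset.lcm_dvd.2 fun b hb => ?_
    rw [Multiset.eq_of_mem_replicate hb]; exact one_dvd _
  exact (Nat.lcm_eq_left this).symm

/-- The law of the order of a uniform random permutation in terms of the chain of cycle lengths. -/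
theorem sum_perm_orderOf (F : ℕ → ℝ) :
    ∑ σ : Equiv.Perm α, F (orderOf σ) =
      (Fintype.card α).factorial * cycExp (Fintype.card α) (fun L => F (gapLcm L)) := by
  simp only [orderOf_eq_lcm_parts]
  rw [← Finset.sum_fiberwise (s := Finset.univ) (g := fun σ : Equiv.Perm α => σ.partition)]
  have h := partExp_eq_cycExp (Fintype.card α) (fun s => F s.lcm)
  unfold gapLcm
  rw [← h, partExp, Finset.mul_sum]
  refine Finset.sum_congr rfl fun p _ => ?_
  rw [Finset.sum_congr rfl (g := fun _ => F p.parts.lcm) fun σ hσ => by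
    rw [(Finset.mem_filter.1 hσ).2], Finset.sum_const, nsmul_eq_mul, card_partition_eq]
  ring

end Perm

/-! ### The cyclic nodes of a map -/

section Cyclic

variable {n : ℕ}

lemma mem_cyclicSet {f : Fin n → Fin n} {x : Fin n} :
    x ∈ cyclicSet f ↔ x ∈ Function.periodicPts f := by
  unfold cyclicSet
  rw [Finset.mem_filter, Function.mem_periodicPts]
  exact and_iff_right (Finset.mem_univ _)

lemma bijOn_cyclicSet (f : Fin n → Fin n) :
    Set.BijOn f (cyclicSet f : Set (Fin n)) (cyclicSet f : Set (Fin n)) := by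
  have : (cyclicSet f : Set (Fin n)) = Function.periodicPts f := by
    ext x; exact mem_cyclicSet
  rw [this]
  exact Function.bijOn_periodicPts f

lemma subset_cyclicSet {f : Fin n → Fin n} {A : Finset (Fin n)} (hm : ∀ x ∈ A, f x ∈ A)
    (hi : Set.InjOn f A) : A ⊆ cyclicSet f := by
  intro x hx
  let g : A → A := fun x => ⟨f x, hm x x.2⟩
  have hg : Function.Injective g := fun a b hab =>
    Subtype.ext (hi a.2 b.2 (congrArg Subtype.val hab))
  obtain ⟨m, hm0, hmx⟩ := hg.mem_periodicPts ⟨x, hx⟩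
  have hsc : Function.Semiconj (Subtype.val : A → Fin n) g f := fun _ => rfl
  refine mem_cyclicSet.2 ⟨m, hm0, ?_⟩
  have := (hsc.iterate_right m) ⟨x, hx⟩
  rw [Function.IsPeriodicPt, Function.IsFixedPt, ← this, hmx]

lemma cyclicSet_subset_comp {f : Fin n → Fin n} (τ : Equiv.Perm (Fin n))
    (hτ : ∀ x, x ∉ cyclicSet f → τ x = x) : cyclicSet f ⊆ cyclicSet (τ ∘ f) := by
  have hmem : ∀ x ∈ cyclicSet f, τ x ∈ cyclicSet f := by
    intro x hx
    by_contra h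
    exact h (by rwa [τ.injective (hτ _ h)])
  refine subset_cyclicSet (fun x hx => hmem _ ((bijOn_cyclicSet f).mapsTo hx)) ?_
  exact τ.injective.comp_injOn (bijOn_cyclicSet f).injOn

lemma cyclicSet_comp {f : Fin n → Fin n} (τ : Equiv.Perm (Fin n))
    (hτ : ∀ x, x ∉ cyclicSet f → τ x = x) : cyclicSet (τ ∘ f) = cyclicSet f := by
  refine Finset.Subset.antisymm ?_ (cyclicSet_subset_comp τ hτ)
  have h := cyclicSet_subset_comp (f := τ ∘ f) τ⁻¹ fun x hx => by
    rw [Equiv.Perm.inv_eq_iff_eq]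
    exact (hτ x fun h => hx (cyclicSet_subset_comp τ hτ h)).symm
  have e : (τ⁻¹ : Equiv.Perm (Fin n)) ∘ τ ∘ f = f := by
    funext x; simp
  rwa [e] at h

/-- Averaging over the permutations of the cyclic nodes does not change sums over families of maps
that are stable under composition with permutations. -/
lemma sum_eq_sum_average {S : Finset (Fin n → Fin n)}
    (hS : ∀ τ : Equiv.Perm (Fin n), ∀ f ∈ S, τ ∘ f ∈ S) (Φ : (Fin n → Fin n) → ℝ) :
    ∑ f ∈ S, Φ f = ∑ f ∈ S, (∑ τ : Equiv.Perm {x // x ∈ cyclicSet f},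
      Φ (Equiv.Perm.ofSubtype τ ∘ f)) / (Zmap f).factorial := by
  rw [← Finset.sum_fiberwise S cyclicSet, ← Finset.sum_fiberwise S cyclicSet]
  refine Finset.sum_congr rfl fun A _ => ?_
  have h1 : ∀ f ∈ S.filter (fun f => cyclicSet f = A),
      (∑ τ : Equiv.Perm {x // x ∈ cyclicSet f}, Φ (Equiv.Perm.ofSubtype τ ∘ f)) /
        ((Zmap f).factorial : ℝ) =
      (∑ τ : Equiv.Perm {x // x ∈ A}, Φ (Equiv.Perm.ofSubtype τ ∘ f)) / (A.card.factorial : ℝ) := by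
    intro f hf
    obtain ⟨_, rfl⟩ := Finset.mem_filter.1 hf
    rfl
  rw [Finset.sum_congr rfl h1, ← Finset.sum_div, Finset.sum_comm]
  have h2 : ∀ τ : Equiv.Perm {x // x ∈ A},
      ∑ f ∈ S.filter (fun f => cyclicSet f = A), Φ (Equiv.Perm.ofSubtype τ ∘ f) =
      ∑ f ∈ S.filter (fun f => cyclicSet f = A), Φ f := by
    intro τ
    have hcl : ∀ τ : Equiv.Perm {x // x ∈ A}, ∀ f ∈ S.filter (fun f => cyclicSet f = A),
        (Equiv.Perm.ofSubtype τ ∘ f) ∈ S.filter (fun f => cyclicSet f = A) := by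
      intro τ f hf
      obtain ⟨hfS, rfl⟩ := Finset.mem_filter.1 hf
      exact Finset.mem_filter.2 ⟨hS _ f hfS,
        cyclicSet_comp _ fun x hx => Equiv.Perm.ofSubtype_apply_of_not_mem τ hx⟩
    refine Finset.sum_bij' (fun f _ => Equiv.Perm.ofSubtype τ ∘ f)
      (fun f _ => Equiv.Perm.ofSubtype τ⁻¹ ∘ f) (hcl τ) (hcl τ⁻¹) ?_ ?_ (fun _ _ => rfl)
    · intro f _; funext x; simp
    · intro f _; funext x; simp
  rw [Finset.sum_congr rfl fun τ _ => h2 τ, Finset.sum_const, Finset.card_univ,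
    Fintype.card_perm, Fintype.card_coe, nsmul_eq_mul, mul_div_cancel_left₀]
  exact_mod_cast (Nat.factorial_pos _).ne'

lemma card_orbit {f : Fin n → Fin n} {x : Fin n} (hx : x ∈ cyclicSet f) :
    ((cyclicSet f).filter fun y => ∃ m, f^[m] x = y).card = Function.minimalPeriod f x := by
  have hx' := mem_cyclicSet.1 hx
  have : ((cyclicSet f).filter fun y => ∃ m, f^[m] x = y) =
      (Finset.range (Function.minimalPeriod f x)).image fun i => f^[i] x := by
    ext y
    simp only [Finset.mem_filter, Finset.mem_image, Finset.mem_range]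
    constructor
    · rintro ⟨_, m, rfl⟩
      exact ⟨m % Function.minimalPeriod f x,
        Nat.mod_lt _ (Function.minimalPeriod_pos_of_mem_periodicPts hx'),
        Function.iterate_mod_minimalPeriod_eq⟩
    · rintro ⟨i, _, rfl⟩
      exact ⟨(bijOn_cyclicSet f).mapsTo.iterate i hx, i, rfl⟩
  rw [this, Finset.card_image_of_injOn, Finset.card_range]
  intro i hi j hj h
  exact Function.iterate_injOn_Iio_minimalPeriod (by simpa using hi) (by simpa using hj) h

lemma Tmap_eq_orderOf {f : Fin n → Fin n} {A : Finset (Fin n)} (hA : cyclicSet f = A)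
    (π : Equiv.Perm {x // x ∈ A}) (hπ : ∀ x, (π x : Fin n) = f x) : Tmap f = orderOf π := by
  subst hA
  have hpow : ∀ d x, ((π ^ d) x : Fin n) = f^[d] x := by
    intro d x
    have hsc : Function.Semiconj (Subtype.val : {x // x ∈ cyclicSet f} → Fin n) π f := hπ
    rw [← hsc.iterate_right d x, Equiv.Perm.iterate_eq_pow]
  refine Nat.dvd_right_iff_eq.1 fun d => ?_
  have h1 : Tmap f ∣ d ↔ ∀ x ∈ cyclicSet f, f^[d] x = x := by
    unfold Tmap cyclesOf
    rw [Finset.lcm_dvd_iff, Finset.forall_mem_image]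
    refine forall₂_congr fun x hx => ?_
    rw [card_orbit hx, ← Function.isPeriodicPt_iff_minimalPeriod_dvd]
    rfl
  rw [h1, orderOf_dvd_iff_pow_eq_one, Equiv.Perm.ext_iff, Subtype.forall]
  refine forall₂_congr fun x hx => ?_
  rw [← hpow d ⟨x, hx⟩, Subtype.ext_iff]
  rfl

lemma mem_zkMaps {k : ℕ} {f : Fin n → Fin n} : f ∈ zkMaps n k ↔ IsZKMap k f := by
  unfold zkMaps
  exact Finset.mem_filter.trans (and_iff_right (Finset.mem_univ _))

lemma comp_mem_zkMaps {k : ℕ} (τ : Equiv.Perm (Fin n)) {f : Fin n → Fin n}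
    (hf : f ∈ zkMaps n k) : τ ∘ f ∈ zkMaps n k := by
  rw [mem_zkMaps] at *
  intro y
  simpa [Function.comp_apply, ← Equiv.eq_symm_apply] using hf (τ.symm y)

/-- Conditionally on the set of cyclic nodes, a random `{0,k}`-map restricts to a uniformly random
permutation of that set. -/
lemma sum_zkMaps_eq (k : ℕ) (Φ : (Fin n → Fin n) → ℝ)
    (Ψ : ∀ A : Finset (Fin n), Equiv.Perm {x // x ∈ A} → ℝ)
    (h : ∀ f, ∀ π : Equiv.Perm {x // x ∈ cyclicSet f}, (∀ x, (π x : Fin n) = f x) →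
      Φ f = Ψ (cyclicSet f) π) :
    ∑ f ∈ zkMaps n k, Φ f =
      ∑ f ∈ zkMaps n k, (∑ σ, Ψ (cyclicSet f) σ) / (Zmap f).factorial := by
  have h' : ∀ f A, cyclicSet f = A → ∀ π : Equiv.Perm {x // x ∈ A},
      (∀ x, (π x : Fin n) = f x) → Φ f = Ψ A π := by
    rintro f _ rfl
    exact h f
  rw [sum_eq_sum_average fun τ f hf => comp_mem_zkMaps τ hf]
  refine Finset.sum_congr rfl fun f _ => congrArg (· / _) ?_
  let c : Equiv.Perm {x // x ∈ cyclicSet f} := (bijOn_cyclicSet f).equiv f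
  have hc : ∀ x, (c x : Fin n) = f x := fun x => rfl
  refine Fintype.sum_equiv (Equiv.mulRight c) _ _ fun τ => ?_
  refine h' _ _ (cyclicSet_comp _ fun x hx => Equiv.Perm.ofSubtype_apply_of_not_mem τ hx) _
    fun x => ?_
  rw [Function.comp_apply, ← hc x, Equiv.Perm.ofSubtype_apply_coe]
  rfl

/-- The sum of a function of `Tmap` over all `{0,k}`-maps, in terms of the cycle lengths of a
random permutation of the cyclic nodes. -/
lemma sum_zkMaps_Tmap (k : ℕ) (F : ℕ → ℝ) :
    ∑ f ∈ zkMaps n k, F (Tmap f) =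
      ∑ f ∈ zkMaps n k, cycExp (Zmap f) fun L => F (gapLcm L) := by
  rw [sum_zkMaps_eq k _ (fun _ σ => F (orderOf σ)) fun f π hπ => by rw [Tmap_eq_orderOf rfl π hπ]]
  refine Finset.sum_congr rfl fun f _ => ?_
  rw [sum_perm_orderOf, Fintype.card_coe, Zmap, mul_div_cancel_left₀]
  exact_mod_cast (Nat.factorial_pos _).ne'

end Cyclic

/-! ### The number of cyclic nodes -/

section CyclicCount

lemma card_perm_extending {m : ℕ} {β : Type*} [Fintype β] [DecidableEq β] (b a : Fin m ↪ β) :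
    (univ.filter fun τ : Equiv.Perm β => ∀ i, τ (b i) = a i).card *
      (Fintype.card β).descFactorial m = (Fintype.card β).factorial := by
  have h1 : ∀ a' ∈ (univ : Finset (Fin m ↪ β)),
      (univ.filter fun τ : Equiv.Perm β => b.trans τ.toEmbedding = a').card =
        (univ.filter fun τ : Equiv.Perm β => ∀ i, τ (b i) = a i).card := by
    intro a' _
    obtain ⟨σ, rfl⟩ := Equiv.Perm.exists_smul_eq_embedding a a'
    refine Finset.card_equiv (Equiv.mulLeft σ⁻¹) fun τ => ?_
    simp only [Finset.mem_filter, Finset.mem_univ, true_and, Function.Embedding.ext_iff]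
    refine forall_congr' fun i => ?_
    simp [Function.Embedding.smul_apply, Equiv.symm_apply_eq]
  have h2 := Finset.card_eq_sum_card_fiberwise (s := (univ : Finset (Equiv.Perm β)))
    (t := (univ : Finset (Fin m ↪ β))) (f := fun τ => b.trans τ.toEmbedding)
    fun _ _ => Finset.mem_coe.2 (Finset.mem_univ _)
  rw [Finset.sum_congr rfl h1, Finset.sum_const, Finset.card_univ, Finset.card_univ,
    Fintype.card_perm, Fintype.card_embedding_eq, Fintype.card_fin, smul_eq_mul] at h2
  rw [h2, mul_comm]

/-- The number of injective `m`-tuples of fixed points of `f`. -/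
def fixCount (m : ℕ) {β : Type*} [Fintype β] [DecidableEq β] (f : β → β) : ℕ :=
  (univ.filter fun a : Fin m ↪ β => ∀ i, f (a i) = a i).card

lemma sum_perm_fixCount (m : ℕ) (β : Type*) [Fintype β] [DecidableEq β] :
    ∑ τ : Equiv.Perm β, fixCount m τ =
      if m ≤ Fintype.card β then (Fintype.card β).factorial else 0 := by
  have h1 : ∑ τ : Equiv.Perm β, fixCount m τ =
      ∑ a : Fin m ↪ β, (univ.filter fun τ : Equiv.Perm β => ∀ i, τ (a i) = a i).card := by
    simp only [fixCount, Finset.card_filter]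
    exact Finset.sum_comm
  split_ifs with h
  · refine Nat.eq_of_mul_eq_mul_right (Nat.descFactorial_pos.2 h) ?_
    rw [h1, Finset.sum_mul, Finset.sum_congr rfl fun a _ => card_perm_extending a a,
      Finset.sum_const, Finset.card_univ, Fintype.card_embedding_eq, Fintype.card_fin,
      smul_eq_mul, mul_comm]
  · have : IsEmpty (Fin m ↪ β) :=
      ⟨fun a => h (by simpa using Fintype.card_le_of_embedding a)⟩
    rw [h1, Finset.univ_eq_empty, Finset.sum_empty]

variable {n : ℕ}

lemma fixCount_eq (m : ℕ) (f : Fin n → Fin n) (π : Equiv.Perm {x // x ∈ cyclicSet f})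
    (hπ : ∀ x, (π x : Fin n) = f x) : fixCount m f = fixCount m π := by
  symm
  unfold fixCount
  refine Finset.card_bij (fun a _ => a.trans (Function.Embedding.subtype _)) ?_ ?_ ?_
  · intro a ha
    simp only [Finset.mem_filter, Finset.mem_univ, true_and] at ha ⊢
    intro i
    have := congrArg Subtype.val (ha i)
    rwa [hπ] at this
  · intro a _ a' _ h
    ext i
    exact congrArg Fin.val (DFunLike.congr_fun h i)
  · intro a ha
    simp only [Finset.mem_filter, Finset.mem_univ, true_and] at ha
    have hmem : ∀ i, a i ∈ cyclicSet f := fun i =>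
      mem_cyclicSet.2 ⟨1, one_pos, ha i⟩
    refine ⟨⟨fun i => ⟨a i, hmem i⟩, fun i j h => a.injective (congrArg Subtype.val h)⟩, ?_, ?_⟩
    · simp only [Finset.mem_filter, Finset.mem_univ, true_and]
      intro i
      exact Subtype.ext ((hπ _).trans (ha i))
    · ext i; rfl

lemma sum_fixCount (m k : ℕ) :
    ∑ f ∈ zkMaps n k, fixCount m f = ((zkMaps n k).filter fun f => m ≤ Zmap f).card := by
  have h := sum_zkMaps_eq (n := n) k (fun f => (fixCount m f : ℝ))
    (fun _ σ => (fixCount m σ : ℝ)) fun f π hπ => by rw [fixCount_eq m f π hπ]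
  have h2 : ∀ f ∈ zkMaps n k, (∑ σ : Equiv.Perm {x // x ∈ cyclicSet f},
      (fixCount m σ : ℝ)) / ((Zmap f).factorial : ℝ) = if m ≤ Zmap f then 1 else 0 := by
    intro f _
    rw [← Nat.cast_sum, sum_perm_fixCount, Fintype.card_coe, ← Zmap]
    split_ifs
    · exact div_self (by exact_mod_cast (Nat.factorial_pos _).ne')
    · simp
  rw [Finset.sum_congr rfl h2, Finset.sum_boole] at h
  exact_mod_cast h

lemma card_injective_comp {k r : ℕ} (hk : 0 < k) (hn : n = k * r) {f : Fin n → Fin n}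
    (hf : f ∈ zkMaps n k) (m : ℕ) :
    (univ.filter fun a : Fin m ↪ Fin n => Function.Injective (f ∘ a)).card =
      k ^ m * r.descFactorial m := by
  have hfib : ∀ y ∈ univ.image f, (univ.filter fun x => f x = y).card = k := by
    intro y hy
    obtain ⟨x, _, rfl⟩ := Finset.mem_image.1 hy
    refine (mem_zkMaps.1 hf (f x)).resolve_left fun h => ?_
    exact Finset.notMem_empty x (Finset.card_eq_zero.1 h ▸ by simp)
  have hR : (univ.image f).card = r := by
    have h := Finset.card_eq_sum_card_image f univ
    rw [Finset.sum_congr rfl hfib, Finset.sum_const, Finset.card_univ, Fintype.card_fin,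
      smul_eq_mul, mul_comm] at h
    exact Nat.eq_of_mul_eq_mul_left hk (h.symm.trans hn)
  let g : (Σ b : Fin m ↪ {y // y ∈ univ.image f}, ∀ i, {x // f x = b i}) →
      {a : Fin m ↪ Fin n // Function.Injective (f ∘ a)} := fun p =>
    ⟨⟨fun i => p.2 i, fun i j h => p.1.injective (Subtype.ext (by
      rw [← (p.2 i).2, ← (p.2 j).2]; exact congrArg f h))⟩, fun i j h =>
      p.1.injective (Subtype.ext (by rw [← (p.2 i).2, ← (p.2 j).2]; exact h))⟩
  have hg : Function.Bijective g := by
    constructor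
    · rintro ⟨b, c⟩ ⟨b', c'⟩ h
      have hval : ∀ i, (c i : Fin n) = c' i := fun i =>
        DFunLike.congr_fun (congrArg Subtype.val h) i
      have hb : b = b' := Function.Embedding.ext fun i => Subtype.ext (by
        rw [← (c i).2, ← (c' i).2, hval])
      subst hb
      exact congrArg (Sigma.mk b) (funext fun i => Subtype.ext (hval i))
    · rintro ⟨a, ha⟩
      exact ⟨⟨⟨fun i => ⟨f (a i), Finset.mem_image_of_mem f (Finset.mem_univ _)⟩,
        fun i j h => ha (congrArg Subtype.val h)⟩, fun i => ⟨a i, rfl⟩⟩, rfl⟩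
  rw [← Fintype.card_subtype, ← Fintype.card_of_bijective hg, Fintype.card_sigma]
  have hc : ∀ b : Fin m ↪ {y // y ∈ univ.image f},
      Fintype.card (∀ i, {x // f x = b i}) = k ^ m := by
    intro b
    rw [Fintype.card_pi, Finset.prod_congr rfl fun i _ =>
      (Fintype.card_subtype _).trans (hfib _ (b i).2), Finset.prod_const, Finset.card_univ,
      Fintype.card_fin]
  rw [Finset.sum_congr rfl fun b _ => hc b, Finset.sum_const, Finset.card_univ,
    Fintype.card_embedding_eq, Fintype.card_coe, hR, Fintype.card_fin, smul_eq_mul, mul_comm]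

/-- The distribution of the number of cyclic nodes of a random `{0,k}`-map. -/
lemma card_filter_le_Zmap {k r : ℕ} (hk : 0 < k) (hn : n = k * r) (m : ℕ) :
    ((zkMaps n k).filter fun f => m ≤ Zmap f).card * n.descFactorial m =
      (zkMaps n k).card * (k ^ m * r.descFactorial m) := by
  rw [← sum_fixCount]
  have h1 : ∀ τ : Equiv.Perm (Fin n), ∑ f ∈ zkMaps n k, fixCount m (τ ∘ f) =
      ∑ f ∈ zkMaps n k, fixCount m f := fun τ =>
    Finset.sum_bij' (fun f _ => τ ∘ f) (fun f _ => (τ⁻¹ : Equiv.Perm (Fin n)) ∘ f)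
      (fun f hf => comp_mem_zkMaps τ hf) (fun f hf => comp_mem_zkMaps τ⁻¹ hf)
      (fun f _ => by funext x; simp) (fun f _ => by funext x; simp) fun _ _ => rfl
  have h2 : ∀ f ∈ zkMaps n k, (∑ τ : Equiv.Perm (Fin n), fixCount m (τ ∘ f)) *
      n.descFactorial m = n.factorial * (k ^ m * r.descFactorial m) := by
    intro f hf
    have h3 : ∑ τ : Equiv.Perm (Fin n), fixCount m (τ ∘ f) = ∑ a : Fin m ↪ Fin n,
        (univ.filter fun τ : Equiv.Perm (Fin n) => ∀ i, τ (f (a i)) = a i).card := by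
      simp only [fixCount, Finset.card_filter]
      exact Finset.sum_comm
    have h4 : ∀ a : Fin m ↪ Fin n,
        (univ.filter fun τ : Equiv.Perm (Fin n) => ∀ i, τ (f (a i)) = a i).card *
          n.descFactorial m = if Function.Injective (f ∘ a) then n.factorial else 0 := by
      intro a
      split_ifs with h
      · simpa using card_perm_extending ⟨f ∘ a, h⟩ a
      · rw [Finset.filter_false_of_mem, Finset.card_empty, zero_mul]
        intro τ _ hτ
        refine h fun i j hij => a.injective ?_
        rw [← hτ i, ← hτ j]
        exact congrArg τ hij
    rw [h3, Finset.sum_mul, Finset.sum_congr rfl fun a _ => h4 a, ← Finset.sum_filter,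
      Finset.sum_const, smul_eq_mul, card_injective_comp hk hn hf, mul_comm]
  have h5 : ∑ f ∈ zkMaps n k, ∑ τ : Equiv.Perm (Fin n), fixCount m (τ ∘ f) =
      n.factorial * ∑ f ∈ zkMaps n k, fixCount m f := by
    rw [Finset.sum_comm, Finset.sum_congr rfl fun τ _ => h1 τ, Finset.sum_const,
      Finset.card_univ, Fintype.card_perm, Fintype.card_fin, smul_eq_mul]
  refine Nat.eq_of_mul_eq_mul_left (Nat.factorial_pos n) ?_
  rw [← mul_assoc, ← h5, Finset.sum_mul, Finset.sum_congr rfl h2, Finset.sum_const, smul_eq_mul]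
  ring

lemma zkMaps_nonempty {k r : ℕ} (hk : 0 < k) (hn : n = k * r) : (zkMaps n k).Nonempty := by
  subst hn
  have hlt : ∀ x : Fin (k * r), (x : ℕ) / k < k * r := fun x =>
    (Nat.div_le_self _ _).trans_lt x.2
  refine ⟨fun x => ⟨x / k, hlt x⟩, mem_zkMaps.2 fun y => ?_⟩
  by_cases hy : (y : ℕ) < r
  · right
    have : (univ.filter fun x : Fin (k * r) => (⟨x / k, hlt x⟩ : Fin (k * r)) = y) =
        (univ : Finset (Fin k)).image fun j => ⟨k * y + j, by
          calc k * (y : ℕ) + j < k * y + k := by omega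
            _ = k * (y + 1) := by ring
            _ ≤ k * r := Nat.mul_le_mul_left k hy⟩ := by
      ext x
      simp only [Finset.mem_filter, Finset.mem_univ, true_and, Finset.mem_image, Fin.ext_iff]
      constructor
      · intro h
        exact ⟨⟨x % k, Nat.mod_lt _ hk⟩, by rw [← h]; exact Nat.div_add_mod _ _⟩
      · rintro ⟨j, hj⟩
        rw [← hj, Nat.mul_add_div hk, Nat.div_eq_of_lt j.2, add_zero]
    rw [this, Finset.card_image_of_injective, Finset.card_univ, Fintype.card_fin]
    intro i j h
    simpa [Fin.ext_iff] using h
  · left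
    rw [Finset.card_eq_zero, Finset.filter_eq_empty_iff]
    intro x _ h
    refine hy ?_
    rw [← h]
    exact Nat.div_lt_of_lt_mul x.2

end CyclicCount

/-! ### Concentration of the number of cyclic nodes -/

section Concentration

variable {n k r : ℕ}

/-- The number of `{0,k}`-maps with at least `m` cyclic nodes. -/
def tailCount (n k m : ℕ) : ℕ := ((zkMaps n k).filter fun f => m ≤ Zmap f).card

lemma tailCount_zero : tailCount n k 0 = (zkMaps n k).card := by
  unfold tailCount
  rw [Finset.filter_true_of_mem fun f _ => Nat.zero_le _]

lemma tailCount_le (m : ℕ) : tailCount n k m ≤ (zkMaps n k).card :=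
  Finset.card_filter_le _ _

lemma tailCount_anti {m m' : ℕ} (h : m ≤ m') : tailCount n k m' ≤ tailCount n k m :=
  Finset.card_le_card (Finset.monotone_filter_right _ fun _ _ h' => h.trans h')

lemma tailCount_succ (hk : 2 ≤ k) (hn : n = k * r) {m : ℕ} (hr : 0 < r) (hm : m ≤ r) :
    (tailCount n k (m + 1) : ℝ) =
      tailCount n k m * (1 - ((k : ℝ) - 1) * m / ((n : ℝ) - m)) := by
  have hnr : r < n := by rw [hn]; nlinarith
  have h0 := card_filter_le_Zmap (by omega : 0 < k) hn m
  have h1 := card_filter_le_Zmap (by omega : 0 < k) hn (m + 1)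
  rw [← tailCount] at h0 h1
  rw [Nat.descFactorial_succ, Nat.descFactorial_succ] at h1
  have hD : 0 < n.descFactorial m := Nat.descFactorial_pos.2 (hm.trans hnr.le)
  have h2 : tailCount n k (m + 1) * (n - m) = tailCount n k m * (k * (r - m)) := by
    refine Nat.eq_of_mul_eq_mul_right hD ?_
    calc tailCount n k (m + 1) * (n - m) * n.descFactorial m
        = tailCount n k (m + 1) * ((n - m) * n.descFactorial m) := by ring
      _ = (zkMaps n k).card * (k ^ (m + 1) * ((r - m) * r.descFactorial m)) := h1
      _ = (zkMaps n k).card * (k ^ m * r.descFactorial m) * (k * (r - m)) := by ring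
      _ = tailCount n k m * n.descFactorial m * (k * (r - m)) := by rw [h0]
      _ = tailCount n k m * (k * (r - m)) * n.descFactorial m := by ring
  have h3 := congrArg (Nat.cast : ℕ → ℝ) h2
  push_cast [Nat.cast_sub hm, Nat.cast_sub (hm.trans hnr.le)] at h3
  have hpos : (0 : ℝ) < (n : ℝ) - m := sub_pos.2 (by exact_mod_cast hm.trans_lt hnr)
  have hn' : (n : ℝ) = k * r := by exact_mod_cast hn
  rw [← mul_div_cancel_right₀ (tailCount n k (m + 1) : ℝ) hpos.ne', h3, one_sub_div hpos.ne',
    mul_div_assoc, hn']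
  ring

lemma tailCount_eq_zero (hk : 2 ≤ k) (hn : n = k * r) (hr : 0 < r) {m : ℕ} (hm : r < m) :
    tailCount n k m = 0 := by
  refine Nat.le_zero.1 ((tailCount_anti hm).trans (Nat.le_zero.2 ?_))
  have h := tailCount_succ hk hn hr le_rfl
  have hpos : (0 : ℝ) < (n : ℝ) - r := by
    have : r < n := by rw [hn]; nlinarith
    exact sub_pos.2 (by exact_mod_cast this)
  have hn' : (n : ℝ) = k * r := by exact_mod_cast hn
  have : ((k : ℝ) - 1) * r = n - r := by rw [hn']; ring
  rw [this, div_self hpos.ne', sub_self, mul_zero] at h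
  exact_mod_cast h

lemma tailCount_mul_le (hk : 2 ≤ k) (hn : n = k * r) (hr : 0 < r) (m : ℕ) :
    (tailCount n k m : ℝ) * (1 + ((k : ℝ) - 1) / n * (m * (m - 1) / 2)) ≤ (zkMaps n k).card := by
  induction m with
  | zero => simp [tailCount_zero]
  | succ m ih =>
    rcases lt_or_ge r m with h | h
    · rw [tailCount_eq_zero hk hn hr (h.trans (Nat.lt_succ_self m))]
      simp
    · have hnr : r < n := by rw [hn]; nlinarith
      have hn0 : (0 : ℝ) < n := by exact_mod_cast hr.trans hnr
      have hpos : (0 : ℝ) < (n : ℝ) - m := sub_pos.2 (by exact_mod_cast h.trans_lt hnr)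
      have hk1 : (0 : ℝ) ≤ (k : ℝ) - 1 := by
        have : (2 : ℝ) ≤ k := by exact_mod_cast hk
        linarith
      set b : ℝ := ((k : ℝ) - 1) / n * m with hb
      have hb0 : 0 ≤ b := by positivity
      have hba : b ≤ ((k : ℝ) - 1) * m / ((n : ℝ) - m) := by
        rw [hb, div_mul_eq_mul_div]
        exact div_le_div_of_nonneg_left (by positivity) hpos
          (by linarith [(Nat.cast_nonneg m : (0 : ℝ) ≤ m)])
      set q : ℝ := ((k : ℝ) - 1) / n * (m * (m - 1) / 2) with hq
      have hq0 : 0 ≤ q := by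
        have : (0 : ℝ) ≤ (m : ℝ) * (m - 1) := by
          rcases Nat.eq_zero_or_pos m with rfl | hm
          · simp
          · have : (1 : ℝ) ≤ m := by exact_mod_cast hm
            nlinarith
        positivity
      have e : 1 + ((k : ℝ) - 1) / n * ((m + 1 : ℕ) * ((m + 1 : ℕ) - 1) / 2) = 1 + q + b := by
        rw [hb, hq]; push_cast; ring
      rw [e, tailCount_succ hk hn hr h, mul_assoc]
      refine le_trans (mul_le_mul_of_nonneg_left ?_ (Nat.cast_nonneg _)) ih
      nlinarith

lemma le_tailCount (hk : 2 ≤ k) (hn : n = k * r) (hr : 0 < r) {m : ℕ} (hm : m ≤ r) :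
    (zkMaps n k).card * (1 - ((k : ℝ) - 1) / n * (m : ℝ) ^ 2) ≤ tailCount n k m := by
  induction m with
  | zero => simp [tailCount_zero]
  | succ m ih =>
    have hmr : m ≤ r := (Nat.le_succ m).trans hm
    have ih := ih hmr
    have hnr : 2 * r ≤ n := by rw [hn]; exact Nat.mul_le_mul_right r hk
    have hnr' : (2 : ℝ) * m ≤ n := by exact_mod_cast (Nat.mul_le_mul_left 2 hmr).trans hnr
    have hn0 : (0 : ℝ) < n := by
      have : 0 < n := by omega
      exact_mod_cast this
    have hk1 : (0 : ℝ) ≤ (k : ℝ) - 1 := by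
      have : (2 : ℝ) ≤ k := by exact_mod_cast hk
      linarith
    have hab : ((k : ℝ) - 1) * m / ((n : ℝ) - m) ≤ ((k : ℝ) - 1) / n * (2 * m) := by
      rw [div_mul_eq_mul_div, div_le_div_iff₀ (by linarith) hn0]
      have : (0 : ℝ) ≤ ((k : ℝ) - 1) * m := by positivity
      nlinarith
    have ha0 : (0 : ℝ) ≤ ((k : ℝ) - 1) / n * (2 * m) := by positivity
    have hc : (tailCount n k m : ℝ) ≤ (zkMaps n k).card := by exact_mod_cast tailCount_le m
    rw [tailCount_succ hk hn hr hmr]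
    calc ((zkMaps n k).card : ℝ) * (1 - ((k : ℝ) - 1) / n * ((m + 1 : ℕ) : ℝ) ^ 2)
        ≤ (zkMaps n k).card * (1 - ((k : ℝ) - 1) / n * (m : ℝ) ^ 2) -
            (zkMaps n k).card * (((k : ℝ) - 1) / n * (2 * m)) := by
          rw [← mul_sub]
          refine mul_le_mul_of_nonneg_left ?_ (Nat.cast_nonneg _)
          have : (0 : ℝ) ≤ ((k : ℝ) - 1) / n := by positivity
          push_cast
          nlinarith
      _ ≤ tailCount n k m - tailCount n k m * (((k : ℝ) - 1) * m / ((n : ℝ) - m)) := by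
          refine sub_le_sub ih ?_
          calc (tailCount n k m : ℝ) * (((k : ℝ) - 1) * m / ((n : ℝ) - m))
              ≤ tailCount n k m * (((k : ℝ) - 1) / n * (2 * m)) :=
                mul_le_mul_of_nonneg_left hab (Nat.cast_nonneg _)
            _ ≤ _ := mul_le_mul_of_nonneg_right hc ha0
      _ = _ := by ring

/-- With high probability, the logarithm of the number of cyclic nodes is close to
`log √(n/λ)`. -/
lemma card_filter_log_Zmap_le (hk : 2 ≤ k) (hn : n = k * r) {w : ℝ} (hw : 10 ≤ w)
    (hL : Real.log (Real.sqrt ((n : ℝ) / ((k : ℝ) - 1))) = w ^ 4) :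
    (((zkMaps n k).filter fun f => ¬ |Real.log (Zmap f) - w ^ 4| ≤ w).card : ℝ) ≤
      (zkMaps n k).card * (8 / w) := by
  have hw4 : w ≤ w ^ 4 := le_self_pow₀ (by linarith) (by norm_num)
  set s := Real.sqrt ((n : ℝ) / ((k : ℝ) - 1)) with hs
  have hk2 : (2 : ℝ) ≤ k := by exact_mod_cast hk
  have hk1 : (0 : ℝ) < (k : ℝ) - 1 := by linarith
  have hn' : (n : ℝ) = k * r := by exact_mod_cast hn
  have hs0 : 0 < s := by
    by_contra h
    have : s = 0 := le_antisymm (not_lt.1 h) (Real.sqrt_nonneg _)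
    rw [this, Real.log_zero] at hL
    linarith
  have hsexp : s = Real.exp (w ^ 4) := by rw [← hL, Real.exp_log hs0]
  have hs2 : s ^ 2 = n / ((k : ℝ) - 1) := Real.sq_sqrt (by positivity)
  have hew : w + 1 ≤ Real.exp w := Real.add_one_le_exp w
  have hse : Real.exp w ≤ s := by rw [hsexp]; exact Real.exp_le_exp.2 hw4
  have hinv : ((k : ℝ) - 1) / n = (s ^ 2)⁻¹ := by rw [hs2, inv_div]
  have hsr : s ≤ r := by
    have h1 : s ^ 2 ≤ 2 * r := by
      rw [hs2, div_le_iff₀ hk1, hn']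
      nlinarith [(Nat.cast_nonneg r : (0 : ℝ) ≤ r)]
    nlinarith
  have hr : 0 < r := by
    have : (0 : ℝ) < r := hs0.trans_le hsr
    exact_mod_cast this
  set E := Real.exp w with hE
  have hE0 : 0 < E := Real.exp_pos w
  set N : ℝ := ((zkMaps n k).card : ℝ) with hN
  have hN0 : 0 ≤ N := Nat.cast_nonneg _
  have hE2 : (E ^ 2)⁻¹ ≤ w⁻¹ := inv_anti₀ (by linarith) (by nlinarith)
  set m₁ := ⌈s / E⌉₊ with hm₁
  set m₂ := ⌈s * E⌉₊ with hm₂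
  have hsub : ((zkMaps n k).filter fun f => ¬ |Real.log (Zmap f) - w ^ 4| ≤ w) ⊆
      ((zkMaps n k).filter fun f => ¬ m₁ ≤ Zmap f) ∪
        ((zkMaps n k).filter fun f => m₂ ≤ Zmap f) := by
    intro f hf
    obtain ⟨hfz, hf⟩ := Finset.mem_filter.1 hf
    rw [Finset.mem_union, Finset.mem_filter, Finset.mem_filter]
    by_contra! hcon
    have hlo := hcon.1 hfz
    have hhi := hcon.2 hfz
    rw [hm₁, Nat.ceil_le] at hlo
    rw [hm₂, Nat.lt_ceil] at hhi
    have hZ : (0 : ℝ) < Zmap f := lt_of_lt_of_le (by positivity) hlo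
    refine hf (abs_le.2 ⟨?_, ?_⟩)
    · have := Real.log_le_log (by positivity) hlo
      rw [Real.log_div hs0.ne' hE0.ne', hL, hE, Real.log_exp] at this
      linarith
    · have := Real.log_le_log hZ hhi.le
      rw [Real.log_mul hs0.ne' hE0.ne', hL, hE, Real.log_exp] at this
      linarith
  have hlow : (((zkMaps n k).filter fun f => ¬ m₁ ≤ Zmap f).card : ℝ) ≤ N * (4 / w) := by
    have hsum : ((tailCount n k m₁ : ℕ) : ℝ) +
        (((zkMaps n k).filter fun f => ¬ m₁ ≤ Zmap f).card : ℝ) = N := by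
      rw [hN, tailCount]
      exact_mod_cast Finset.card_filter_add_card_filter_not (s := zkMaps n k) fun f => m₁ ≤ Zmap f
    have hm : (m₁ : ℝ) ≤ 2 * (s / E) := by
      have h1 := (Nat.ceil_lt_add_one (by positivity : 0 ≤ s / E)).le
      have h2 : 1 ≤ s / E := (one_le_div hE0).2 hse
      linarith
    have hmr : m₁ ≤ r := by
      have : 2 * (s / E) ≤ s := by
        rw [← mul_div_assoc, div_le_iff₀ hE0]
        nlinarith
      exact_mod_cast hm.trans (this.trans hsr)
    have hle := le_tailCount hk hn hr hmr
    have h3 : ((k : ℝ) - 1) / n * (m₁ : ℝ) ^ 2 ≤ 4 / w := by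
      calc ((k : ℝ) - 1) / n * (m₁ : ℝ) ^ 2 ≤ (s ^ 2)⁻¹ * (2 * (s / E)) ^ 2 := by
            rw [hinv]; gcongr
        _ = 4 * (E ^ 2)⁻¹ := by field_simp; norm_num
        _ ≤ 4 * w⁻¹ := by linarith
        _ = 4 / w := rfl
    have h4 := mul_le_mul_of_nonneg_left h3 hN0
    rw [← hN, mul_sub, mul_one] at hle
    linarith
  have hup : (((zkMaps n k).filter fun f => m₂ ≤ Zmap f).card : ℝ) ≤ N * (4 / w) := by
    have hle := tailCount_mul_le hk hn hr m₂
    rw [← hN, hinv] at hle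
    have hm : s * E ≤ m₂ := Nat.le_ceil _
    have hm2 : 2 ≤ (m₂ : ℝ) := by nlinarith
    have h1 : E ^ 2 / 4 ≤ 1 + (s ^ 2)⁻¹ * ((m₂ : ℝ) * (m₂ - 1) / 2) := by
      have h2 : (s * E) ^ 2 ≤ (m₂ : ℝ) ^ 2 := by gcongr
      have h3 : (s * E) ^ 2 / 4 ≤ (m₂ : ℝ) * (m₂ - 1) / 2 := by nlinarith
      have h4 := mul_le_mul_of_nonneg_left h3 (by positivity : 0 ≤ (s ^ 2)⁻¹)
      have h5 : (s ^ 2)⁻¹ * ((s * E) ^ 2 / 4) = E ^ 2 / 4 := by field_simp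
      linarith
    have h6 : (tailCount n k m₂ : ℝ) * (E ^ 2 / 4) ≤ N :=
      (mul_le_mul_of_nonneg_left h1 (Nat.cast_nonneg _)).trans hle
    change (tailCount n k m₂ : ℝ) ≤ _
    calc (tailCount n k m₂ : ℝ) ≤ N / (E ^ 2 / 4) := (le_div_iff₀ (by positivity)).2 h6
      _ = N * (4 * (E ^ 2)⁻¹) := by field_simp
      _ ≤ N * (4 * w⁻¹) := by gcongr
      _ = N * (4 / w) := rfl
  calc (((zkMaps n k).filter fun f => ¬ |Real.log (Zmap f) - w ^ 4| ≤ w).card : ℝ)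
      ≤ (((zkMaps n k).filter fun f => ¬ m₁ ≤ Zmap f).card : ℝ) +
          (((zkMaps n k).filter fun f => m₂ ≤ Zmap f).card : ℝ) := by
        exact_mod_cast (Finset.card_le_card hsub).trans (Finset.card_union_le _ _)
    _ ≤ N * (4 / w) + N * (4 / w) := add_le_add hlow hup
    _ = N * (8 / w) := by ring

end Concentration

/-! ### Asymptotic normality -/

lemma exists_abs_zkProb_sub_le : ∃ C : ℝ, 0 < C ∧ ∀ w : ℝ, 10 ≤ w → ∀ n k r : ℕ, 2 ≤ k →
    n = k * r → Real.log (Real.sqrt ((n : ℝ) / ((k : ℝ) - 1))) = w ^ 4 → ∀ x : ℝ,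
      |zkProb n k (fun f => Real.log (Tmap f) ≤ w ^ 8 / 2 + (Real.sqrt 3)⁻¹ * w ^ 6 * x) -
        stdNormalCDF x| ≤ C * (|x| + w ^ 2) / w ^ 3 := by
  obtain ⟨C, hC0, hC⟩ := exists_abs_cycExp_log_gapLcm_sub_le
  refine ⟨C + 8, by linarith, fun w hw n k r hk hn hL x => ?_⟩
  set y := w ^ 8 / 2 + (Real.sqrt 3)⁻¹ * w ^ 6 * x with hy
  have hw0 : 0 < w := by linarith
  have hN : 0 < ((zkMaps n k).card : ℝ) := by
    exact_mod_cast (zkMaps_nonempty (by omega : 0 < k) hn).card_pos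
  set N : ℝ := ((zkMaps n k).card : ℝ) with hNdef
  set g : ℕ → ℝ := fun m => cycExp m fun L => if Real.log (gapLcm L) ≤ y then 1 else 0 with hg
  have hg0 : ∀ m, 0 ≤ g m := fun m => cycExp_nonneg fun L _ => by split_ifs <;> norm_num
  have hg1 : ∀ m, g m ≤ 1 := fun m =>
    (cycExp_mono fun L _ => by split_ifs <;> norm_num).trans_eq (cycExp_const m 1)
  have hprob : zkProb n k (fun f => Real.log (Tmap f) ≤ y) = (∑ f ∈ zkMaps n k, g (Zmap f)) / N := by
    rw [zkProb, ← hNdef, ← sum_zkMaps_Tmap k fun t => if Real.log (t : ℝ) ≤ y then 1 else 0,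
      Finset.sum_boole]
  have hdiff : zkProb n k (fun f => Real.log (Tmap f) ≤ y) - stdNormalCDF x =
      (∑ f ∈ zkMaps n k, (g (Zmap f) - stdNormalCDF x)) / N := by
    rw [hprob, Finset.sum_sub_distrib, Finset.sum_const, nsmul_eq_mul, ← hNdef, sub_div,
      mul_div_cancel_left₀ _ hN.ne']
  set B := C * (|x| + w ^ 2) / w ^ 3 with hB
  have hB0 : 0 ≤ B := by positivity
  have hpt : ∀ f ∈ zkMaps n k, |g (Zmap f) - stdNormalCDF x| ≤
      B + if ¬ |Real.log (Zmap f) - w ^ 4| ≤ w then 1 else 0 := by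
    intro f _
    split_ifs with h
    · rw [add_zero]
      exact hC w hw _ h x
    · have h0 := stdNormalCDF_nonneg x
      have h1 := stdNormalCDF_le_one x
      have h2 := hg0 (Zmap f)
      have h3 := hg1 (Zmap f)
      have : |g (Zmap f) - stdNormalCDF x| ≤ 1 := abs_le.2 ⟨by linarith, by linarith⟩
      linarith
  rw [hdiff, abs_div, abs_of_pos hN, div_le_iff₀ hN]
  calc |∑ f ∈ zkMaps n k, (g (Zmap f) - stdNormalCDF x)|
      ≤ ∑ f ∈ zkMaps n k, (B + if ¬ |Real.log (Zmap f) - w ^ 4| ≤ w then 1 else 0) :=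
        (Finset.abs_sum_le_sum_abs _ _).trans (Finset.sum_le_sum hpt)
    _ = N * B + ((zkMaps n k).filter fun f => ¬ |Real.log (Zmap f) - w ^ 4| ≤ w).card := by
        rw [Finset.sum_add_distrib, Finset.sum_const, nsmul_eq_mul, Finset.sum_boole]
    _ ≤ N * B + N * (8 / w) := by gcongr; exact card_filter_log_Zmap_le hk hn hw hL
    _ = (B + 8 * w ^ 2 / w ^ 3) * N := by field_simp
    _ ≤ (C + 8) * (|x| + w ^ 2) / w ^ 3 * N := by
        refine mul_le_mul_of_nonneg_right ?_ hN.le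
        rw [hB, ← add_div]
        gcongr
        nlinarith [abs_nonneg x]

/-- `log T` is asymptotically normal over `{0,k}`-mappings, with an
explicit error bound. -/
theorem stmt_12 (k n : ℕ → ℕ) (α : ℝ) (hα1 : 0 < α) (hα2 : α < 1)
    (hk : ∀ r, 2 ≤ k r) (hn : ∀ r, n r = k r * r)
    (hko : (fun r : ℕ => (k r : ℝ)) =o[atTop] (fun r : ℕ => (n r : ℝ) ^ (1 - α)))
    (lam μ σn : ℕ → ℝ)
    (hlam : ∀ r, lam r = (k r : ℝ) - 1)
    (hμ : ∀ r, μ r = 1 / 2 * (Real.log (Real.sqrt ((n r : ℝ) / lam r))) ^ 2)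
    (hσ : ∀ r, σn r =
      (Real.sqrt 3)⁻¹ * (Real.log (Real.sqrt ((n r : ℝ) / lam r))) ^ ((3 : ℝ) / 2)) :
    (∀ x : ℝ,
      Tendsto (fun r => zkProb (n r) (k r)
          (fun f => Real.log ((Tmap f : ℝ)) ≤ μ r + x * σn r))
        atTop (nhds (stdNormalCDF x))) ∧
    ∃ C : ℝ, 0 < C ∧
      ∀ᶠ r : ℕ in atTop, ∀ x : ℝ,
        |zkProb (n r) (k r) (fun f => Real.log ((Tmap f : ℝ)) ≤ μ r + x * σn r) -
            stdNormalCDF x| ≤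
          C * (|x| + (Real.log (Real.sqrt ((n r : ℝ) / lam r))) ^ ((1 : ℝ) / 2)) /
            (Real.log (Real.sqrt ((n r : ℝ) / lam r))) ^ ((3 : ℝ) / 4) := by
  set L : ℕ → ℝ := fun r => Real.log (Real.sqrt ((n r : ℝ) / lam r)) with hLdef
  have hLtop : Tendsto L atTop atTop := by
    have h1 : Tendsto (fun r : ℕ => Real.log (Real.sqrt (r : ℝ))) atTop atTop :=
      Real.tendsto_log_atTop.comp (Real.tendsto_sqrt_atTop.comp tendsto_natCast_atTop_atTop)
    refine tendsto_atTop_mono' atTop ?_ h1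
    filter_upwards [eventually_gt_atTop 0] with r hr
    have hr' : (0 : ℝ) < r := by exact_mod_cast hr
    have hk2 : (2 : ℝ) ≤ k r := by exact_mod_cast hk r
    refine Real.log_le_log (Real.sqrt_pos.2 hr') (Real.sqrt_le_sqrt ?_)
    rw [hlam, hn, le_div_iff₀ (by linarith)]
    push_cast
    nlinarith
  set w : ℕ → ℝ := fun r => L r ^ ((1 : ℝ) / 4) with hwdef
  have hwtop : Tendsto w atTop atTop :=
    (tendsto_rpow_atTop (by norm_num : (0 : ℝ) < 1 / 4)).comp hLtop
  obtain ⟨C, hC0, hC⟩ := exists_abs_zkProb_sub_le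
  have hmain : ∀ᶠ r : ℕ in atTop, 10 ≤ w r ∧ L r ^ ((1 : ℝ) / 2) = w r ^ 2 ∧
      L r ^ ((3 : ℝ) / 4) = w r ^ 3 ∧ ∀ x : ℝ,
      |zkProb (n r) (k r) (fun f => Real.log ((Tmap f : ℝ)) ≤ μ r + x * σn r) -
        stdNormalCDF x| ≤ C * (|x| + w r ^ 2) / w r ^ 3 := by
    filter_upwards [hwtop.eventually_ge_atTop 10, hLtop.eventually_ge_atTop 0] with r hw hL
    have hpow : ∀ j : ℕ, w r ^ j = L r ^ ((1 : ℝ) / 4 * j) := fun j =>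
      (Real.rpow_mul_natCast hL _ j).symm
    have h4 : w r ^ 4 = L r := by rw [hpow]; norm_num
    have hμ' : μ r = w r ^ 8 / 2 := by
      rw [hμ]
      change 1 / 2 * L r ^ 2 = _
      rw [← h4]
      ring
    have hσ' : σn r = (Real.sqrt 3)⁻¹ * w r ^ 6 := by
      rw [hσ, hpow]
      norm_num [hLdef]
    refine ⟨hw, by rw [hpow]; norm_num, by rw [hpow]; norm_num, fun x => ?_⟩
    have := hC (w r) hw (n r) (k r) r (hk r) (hn r) (by rw [h4, ← hlam]) x
    rwa [hμ', hσ', mul_comm x]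
  refine ⟨fun x => ?_, C, hC0, ?_⟩
  · rw [tendsto_iff_dist_tendsto_zero]
    have hlim : Tendsto (fun r => C * (|x| + 1) / w r) atTop (nhds 0) :=
      hwtop.const_div_atTop _
    refine squeeze_zero' (Eventually.of_forall fun _ => dist_nonneg) ?_ hlim
    filter_upwards [hmain] with r hr
    obtain ⟨hw, -, -, h⟩ := hr
    refine (h x).trans ?_
    have hw0 : 0 < w r := by linarith
    rw [div_le_div_iff₀ (by positivity) hw0]
    have hx : |x| ≤ |x| * w r ^ 2 := le_mul_of_one_le_right (abs_nonneg x) (by nlinarith)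
    have h1 : C * w r * |x| ≤ C * w r * (|x| * w r ^ 2) :=
      mul_le_mul_of_nonneg_left hx (by positivity)
    linarith
  · filter_upwards [hmain] with r hr x
    obtain ⟨-, h2, h3, h⟩ := hr
    rw [show Real.log (Real.sqrt ((n r : ℝ) / lam r)) = L r from rfl, h2, h3]
    exact h x
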